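/- arXiv:0708.0531 — 2 statements merged into one kernel-verified Lean document; each statement's English description precedes it below -/
import Mathlib

section
/- Let λ₁, λ₂ : CS^{∉ℤ}(ℝ^d) → ℂ be linear, both coinciding with the same ρ on CS^{∉ℤ}(ℝ^d) ∩ CS^{<−d}(ℝ^d). If λ₁ and λ₂ are both ℤ^d-translation invariant, or both ℝ^d-translation invariant, then λ₁ = λ₂ on all of CS^{∉ℤ}(ℝ^d): a translation invariant linear form on non-integer order classical symbols is entirely determined by its restriction to L¹ symbols. -/
open MeasureTheory Filter Finset Complex Metric
open scoped Topology Pointwise Classical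

noncomputable section

/-- A smooth cut-off function on `ℝ^d`: vanishes near `0`, identically `1` for `|x| ≥ 1`. -/
structure IsCutoff {d : ℕ} (χ : EuclideanSpace ℝ (Fin d) → ℝ) : Prop where
  smooth : ContDiff ℝ (⊤ : ℕ∞) χ
  eq_zero_near : ∃ ε > (0 : ℝ), ∀ x : EuclideanSpace ℝ (Fin d), ‖x‖ < ε → χ x = 0
  eq_one_far : ∀ x : EuclideanSpace ℝ (Fin d), 1 ≤ ‖x‖ → χ x = 1

/-- `σ` is a classical symbol (with constant coefficients) of order `a ∈ ℂ` on `ℝ^d`, with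
positively homogeneous components `σh j` of degree `a − j` and cut-off `χ`: for every `N` the
function `σ − Σ_{j<N} χ σh j` together with all its derivatives is
`O((1+|x|)^{Re a − N − k})`. -/
structure IsClassicalSymbol {d : ℕ} (χ : EuclideanSpace ℝ (Fin d) → ℝ) (a : ℂ)
    (σ : EuclideanSpace ℝ (Fin d) → ℂ) (σh : ℕ → EuclideanSpace ℝ (Fin d) → ℂ) : Prop where
  smooth : ContDiff ℝ (⊤ : ℕ∞) σ
  smooth_homog : ∀ j : ℕ, ContDiffOn ℝ (⊤ : ℕ∞) (σh j) {x : EuclideanSpace ℝ (Fin d) | x ≠ 0}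
  homog : ∀ j : ℕ, ∀ t : ℝ, 0 < t → ∀ x : EuclideanSpace ℝ (Fin d), x ≠ 0 →
    σh j (t • x) = (t : ℂ) ^ (a - (j : ℂ)) * σh j x
  estimate : ∀ N k : ℕ, ∃ C : ℝ, ∀ x : EuclideanSpace ℝ (Fin d),
    ‖iteratedFDeriv ℝ k
        (fun y : EuclideanSpace ℝ (Fin d) => σ y - ∑ j ∈ Finset.range N, (χ y : ℂ) * σh j y) x‖
      ≤ C * (1 + ‖x‖) ^ (a.re - N - k)

/-- The surface measure `μ_S` on the unit sphere `S^{d−1} ⊂ ℝ^d` induced by Lebesgue measure. -/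
noncomputable def sphereMeasure (d : ℕ) : Measure (sphere (0 : EuclideanSpace ℝ (Fin d)) 1) :=
  (volume : Measure (EuclideanSpace ℝ (Fin d))).toSphere

/-- `σ` is a classical symbol of order `a` on `ℝ^d` (for some cut-off and homogeneous
components). -/
def IsSymbolOfOrder {d : ℕ} (a : ℂ) (σ : EuclideanSpace ℝ (Fin d) → ℂ) : Prop :=
  ∃ (χ : EuclideanSpace ℝ (Fin d) → ℝ) (σh : ℕ → EuclideanSpace ℝ (Fin d) → ℂ),
    IsCutoff χ ∧ IsClassicalSymbol χ a σ σh

/-- `CS^{∉ℤ}(ℝ^d)`: classical symbols of non-integer order. -/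
def CSNonInt (d : ℕ) : Set (EuclideanSpace ℝ (Fin d) → ℂ) :=
  {σ | ∃ a : ℂ, (∀ m : ℤ, a ≠ m) ∧ IsSymbolOfOrder a σ}

/-- `CS^{<−d}(ℝ^d)`: classical symbols of order `a` with `Re(a) < −d`. -/
def CSNeg (d : ℕ) : Set (EuclideanSpace ℝ (Fin d) → ℂ) :=
  {σ | ∃ a : ℂ, a.re < -(d : ℝ) ∧ IsSymbolOfOrder a σ}

/-- Partial derivative `∂_i` of a function on `ℝ^d`. -/
noncomputable def pderiv' {d : ℕ} (i : Fin d) (f : EuclideanSpace ℝ (Fin d) → ℂ) :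
    EuclideanSpace ℝ (Fin d) → ℂ :=
  fun x => fderiv ℝ f x (EuclideanSpace.single i 1)

/-- Multi-index partial derivative `∂^β = ∂_0^{β 0} ⋯ ∂_{d-1}^{β (d-1)}`. -/
noncomputable def mderiv {d : ℕ} (β : Fin d → ℕ) (f : EuclideanSpace ℝ (Fin d) → ℂ) :
    EuclideanSpace ℝ (Fin d) → ℂ :=
  (List.finRange d).foldr (fun i g => (pderiv' i)^[β i] g) f

/-- The multi-indices `β` on `ℝ^d` with `|β| ≤ N`. -/
noncomputable def multiLE (d N : ℕ) : Finset (Fin d → ℕ) :=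
  (Fintype.piFinset fun _ : Fin d => Finset.range (N + 1)).filter fun β => ∑ i, β i ≤ N

/-- The multi-indices `β` on `ℝ^d` with `|β| = N`. -/
noncomputable def multiEQ (d N : ℕ) : Finset (Fin d → ℕ) :=
  (Fintype.piFinset fun _ : Fin d => Finset.range (N + 1)).filter fun β => ∑ i, β i = N

/-- `p^β = ∏_i p_i^{β_i}` (as a complex number), for `p ∈ ℝ^d` and a multi-index `β`. -/
noncomputable def mpow {d : ℕ} (p : EuclideanSpace ℝ (Fin d)) (β : Fin d → ℕ) : ℂ :=
  ∏ i, ((p i : ℝ) : ℂ) ^ β i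

/-- `β! = ∏_i (β_i)!` (as a complex number), for a multi-index `β`. -/
noncomputable def mfac {d : ℕ} (β : Fin d → ℕ) : ℂ := ∏ i, ((β i).factorial : ℂ)

/-- The vector of `ℝ^d` with integer coordinates `p ∈ ℤ^d`. -/
noncomputable def intVec {d : ℕ} (p : Fin d → ℤ) : EuclideanSpace ℝ (Fin d) :=
  (EuclideanSpace.equiv (Fin d) ℝ).symm fun i => (p i : ℝ)

/-- `ρ` is a linear form on `L¹(ℝ^d)`. -/
def RhoLinear {d : ℕ} (ρ : (EuclideanSpace ℝ (Fin d) → ℂ) → ℂ) : Prop :=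
  (∀ f g : EuclideanSpace ℝ (Fin d) → ℂ, Integrable f → Integrable g →
      ρ (f + g) = ρ f + ρ g) ∧
  ∀ (c : ℂ) (f : EuclideanSpace ℝ (Fin d) → ℂ), Integrable f → ρ (c • f) = c * ρ f

/-- `ρ` satisfies the Taylor expansion property (eq. (1.2) of the paper) on `CS^{<−d}(ℝ^d)`:
`ρ(σ(·+p)) = Σ_{|β|≤N} ρ(∂^βσ) p^β/β! + Σ_{|β|=N+1} (p^β/β!) ∫₀¹ (1−t)^N ρ(∂^βσ(·+tp)) dt`. -/
def RhoTaylor {d : ℕ} (ρ : (EuclideanSpace ℝ (Fin d) → ℂ) → ℂ) : Prop :=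
  ∀ σ ∈ CSNeg d, ∀ p : EuclideanSpace ℝ (Fin d), ∀ N : ℕ,
    ρ (fun x => σ (x + p)) =
      (∑ β ∈ multiLE d N, (mpow p β / mfac β) * ρ (mderiv β σ))
        + ∑ β ∈ multiEQ d (N + 1), (mpow p β / mfac β) *
            ∫ t in (0 : ℝ)..1, (((1 - t) ^ N : ℝ) : ℂ) *
              ρ (fun x => mderiv β σ (x + t • p))

/-- `lam` is a linear form on `CS^{∉ℤ}(ℝ^d)` (it preserves linear combinations that lie in
the set). -/
def LamLinear {d : ℕ} (lam : (EuclideanSpace ℝ (Fin d) → ℂ) → ℂ) : Prop :=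
  ∀ (c : ℂ) (σ τ : EuclideanSpace ℝ (Fin d) → ℂ),
    σ ∈ CSNonInt d → τ ∈ CSNonInt d → (c • σ + τ) ∈ CSNonInt d →
      lam (c • σ + τ) = c * lam σ + lam τ

/-- `lam` (extending `ρ`) is `ℝ^d`-translation invariant: for every non-integer order symbol
`σ` of order `a`, every `N` with `N+1 > Re(a)+d` and every `p ∈ ℝ^d`,
`Σ_{0<|β|≤N} lam(∂^βσ) p^β/β! + Σ_{|β|=N+1} (p^β/β!) ∫₀¹ (1−t)^N ρ(∂^βσ(·+tp)) dt = 0`. -/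
def RdTranslationInvariant {d : ℕ}
    (lam ρ : (EuclideanSpace ℝ (Fin d) → ℂ) → ℂ) : Prop :=
  ∀ (a : ℂ) (σ : EuclideanSpace ℝ (Fin d) → ℂ), (∀ m : ℤ, a ≠ m) → IsSymbolOfOrder a σ →
    ∀ N : ℕ, a.re + d < N + 1 → ∀ p : EuclideanSpace ℝ (Fin d),
      (∑ β ∈ (multiLE d N).filter (fun β => β ≠ 0), (mpow p β / mfac β) * lam (mderiv β σ))
        + ∑ β ∈ multiEQ d (N + 1), (mpow p β / mfac β) *
            ∫ t in (0 : ℝ)..1, (((1 - t) ^ N : ℝ) : ℂ) *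
              ρ (fun x => mderiv β σ (x + t • p)) = 0

/-- `lam` (extending `ρ`) is `ℤ^d`-translation invariant. -/
def ZdTranslationInvariant {d : ℕ}
    (lam ρ : (EuclideanSpace ℝ (Fin d) → ℂ) → ℂ) : Prop :=
  ∀ (a : ℂ) (σ : EuclideanSpace ℝ (Fin d) → ℂ), (∀ m : ℤ, a ≠ m) → IsSymbolOfOrder a σ →
    ∀ N : ℕ, a.re + d < N + 1 → ∀ p : Fin d → ℤ,
      (∑ β ∈ (multiLE d N).filter (fun β => β ≠ 0),
          (mpow (intVec p) β / mfac β) * lam (mderiv β σ))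
        + ∑ β ∈ multiEQ d (N + 1), (mpow (intVec p) β / mfac β) *
            ∫ t in (0 : ℝ)..1, (((1 - t) ^ N : ℝ) : ℂ) *
              ρ (fun x => mderiv β σ (x + t • intVec p)) = 0

section SymbolBound

variable {d : ℕ}

/-- `f` is smooth and satisfies the symbol estimates of real order `s`. -/
structure SymbolBound (s : ℝ) (f : EuclideanSpace ℝ (Fin d) → ℂ) : Prop where
  smooth : ContDiff ℝ (⊤ : ℕ∞) f
  bound : ∀ k : ℕ, ∃ C : ℝ, ∀ x : EuclideanSpace ℝ (Fin d),
    ‖iteratedFDeriv ℝ k f x‖ ≤ C * (1 + ‖x‖) ^ (s - k)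

namespace SymbolBound

variable {s t : ℝ} {f g : EuclideanSpace ℝ (Fin d) → ℂ}

lemma contDiff_nat (hf : SymbolBound s f) (k : ℕ) : ContDiff ℝ k f :=
  hf.smooth.of_le (by exact_mod_cast le_top)

lemma add (hf : SymbolBound s f) (hg : SymbolBound s g) : SymbolBound s (f + g) := by
  refine ⟨hf.smooth.add hg.smooth, fun k => ?_⟩
  obtain ⟨C, hC⟩ := hf.bound k
  obtain ⟨C', hC'⟩ := hg.bound k
  refine ⟨C + C', fun x => ?_⟩
  rw [iteratedFDeriv_add_apply (hf.contDiff_nat k).contDiffAt (hg.contDiff_nat k).contDiffAt,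
    add_mul]
  exact (norm_add_le _ _).trans (add_le_add (hC x) (hC' x))

lemma mono (hf : SymbolBound s f) (hst : s ≤ t) : SymbolBound t f := by
  refine ⟨hf.smooth, fun k => ?_⟩
  obtain ⟨C, hC⟩ := hf.bound k
  refine ⟨|C|, fun x => (hC x).trans ?_⟩
  have h1 : (1 : ℝ) ≤ 1 + ‖x‖ := le_add_of_nonneg_right (norm_nonneg x)
  exact mul_le_mul (le_abs_self C)
    (Real.rpow_le_rpow_of_exponent_le h1 (by linarith)) (by positivity) (abs_nonneg C)

lemma const (c : ℂ) : SymbolBound 0 (fun _ : EuclideanSpace ℝ (Fin d) => c) := by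
  refine ⟨contDiff_const, fun k => ?_⟩
  rcases eq_or_ne k 0 with rfl | hk
  · exact ⟨‖c‖, fun x => by simp⟩
  · exact ⟨0, fun x => by rw [iteratedFDeriv_const_of_ne hk]; simp⟩

lemma mul (hf : SymbolBound s f) (hg : SymbolBound t g) : SymbolBound (s + t) (f * g) := by
  refine ⟨hf.smooth.mul hg.smooth, fun k => ?_⟩
  choose C hC using hf.bound
  choose C' hC' using hg.bound
  refine ⟨∑ i ∈ Finset.range (k + 1), (k.choose i : ℝ) * |C i| * |C' (k - i)|, fun x => ?_⟩
  have h0 : 0 < 1 + ‖x‖ := by positivity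
  refine (norm_iteratedFDeriv_mul_le hf.smooth hg.smooth x
    (by exact_mod_cast le_top)).trans ?_
  rw [Finset.sum_mul]
  refine Finset.sum_le_sum fun i hi => ?_
  have hik : i ≤ k := Nat.lt_succ_iff.mp (Finset.mem_range.mp hi)
  have hexp : s + t - k = (s - i) + (t - (k - i : ℕ)) := by
    push_cast [Nat.cast_sub hik]; ring
  have h1 : ‖iteratedFDeriv ℝ i f x‖ ≤ |C i| * (1 + ‖x‖) ^ (s - i) :=
    (hC i x).trans (mul_le_mul_of_nonneg_right (le_abs_self _) (by positivity))
  have h2 : ‖iteratedFDeriv ℝ (k - i) g x‖ ≤ |C' (k - i)| * (1 + ‖x‖) ^ (t - (k - i : ℕ)) :=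
    (hC' _ x).trans (mul_le_mul_of_nonneg_right (le_abs_self _) (by positivity))
  rw [hexp, Real.rpow_add h0]
  calc _ ≤ (k.choose i : ℝ) * (|C i| * (1 + ‖x‖) ^ (s - i)) *
        (|C' (k - i)| * (1 + ‖x‖) ^ (t - (k - i : ℕ))) := by gcongr
    _ = _ := by ring

lemma const_smul (c : ℂ) (hf : SymbolBound s f) : SymbolBound s (c • f) := by
  simpa using! (const (d := d) c).mul hf

lemma sub (hf : SymbolBound s f) (hg : SymbolBound s g) : SymbolBound s (f - g) := by
  have := hf.add (hg.const_smul (-1))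
  simpa [sub_eq_add_neg] using this

lemma zero : SymbolBound s (0 : EuclideanSpace ℝ (Fin d) → ℂ) :=
  ⟨contDiff_const, fun k => ⟨0, fun x => by simp⟩⟩

lemma sum {ι : Type*} (S : Finset ι) {F : ι → EuclideanSpace ℝ (Fin d) → ℂ}
    (hF : ∀ i ∈ S, SymbolBound s (F i)) : SymbolBound s (∑ i ∈ S, F i) :=
  Finset.sum_induction _ _ (fun _ _ => add) zero hF

lemma coord (i : Fin d) :
    SymbolBound 1 (fun x : EuclideanSpace ℝ (Fin d) => ((x i : ℝ) : ℂ)) := by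
  let L : EuclideanSpace ℝ (Fin d) →L[ℝ] ℂ :=
    Complex.ofRealCLM.comp (EuclideanSpace.proj i : EuclideanSpace ℝ (Fin d) →L[ℝ] ℝ)
  change SymbolBound 1 L
  refine ⟨L.contDiff, fun k => ?_⟩
  match k with
  | 0 =>
    refine ⟨‖L‖, fun x => ?_⟩
    simp only [norm_iteratedFDeriv_zero, Nat.cast_zero, sub_zero, Real.rpow_one]
    exact (L.le_opNorm x).trans (by gcongr; linarith)
  | 1 =>
    refine ⟨‖L‖, fun x => ?_⟩
    rw [← zero_add 1, ← norm_iteratedFDeriv_fderiv]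
    simp
  | k + 2 =>
    refine ⟨0, fun x => ?_⟩
    rw [← norm_iteratedFDeriv_fderiv]
    have : fderiv ℝ L = fun _ => L := by ext1 x; exact L.fderiv
    rw [this, iteratedFDeriv_const_of_ne (by simp)]
    simp

lemma pderiv (hf : SymbolBound s f) (i : Fin d) : SymbolBound (s - 1) (pderiv' i f) := by
  have hfd : ContDiff ℝ (⊤ : ℕ∞) (fderiv ℝ f) := hf.smooth.fderiv_right (by simp)
  refine ⟨hfd.clm_apply contDiff_const, fun k => ?_⟩
  obtain ⟨C, hC⟩ := hf.bound (k + 1)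
  refine ⟨C, fun x => ?_⟩
  refine (norm_iteratedFDeriv_clm_apply_const hfd.contDiffAt
    (by exact_mod_cast le_top)).trans ?_
  rw [norm_iteratedFDeriv_fderiv]
  refine le_trans (le_of_eq ?_) ((hC x).trans (le_of_eq ?_))
  · simp
  · push_cast; ring_nf

/-- Smooth functions vanishing outside the unit ball satisfy the estimates of every order. -/
lemma of_eq_zero (hf : ContDiff ℝ (⊤ : ℕ∞) f) (h0 : ∀ x, 1 < ‖x‖ → f x = 0) :
    SymbolBound s f := by
  refine ⟨hf, fun k => ?_⟩
  have hsupp : HasCompactSupport f := by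
    refine HasCompactSupport.intro (isCompact_closedBall (0 : EuclideanSpace ℝ (Fin d)) 1) ?_
    intro x hx
    exact h0 x (by simpa using hx)
  have hcont : Continuous fun x : EuclideanSpace ℝ (Fin d) =>
      (1 + ‖x‖) ^ (-(s - k)) * ‖iteratedFDeriv ℝ k f x‖ := by
    refine Continuous.mul ?_ (hf.continuous_iteratedFDeriv (by exact_mod_cast le_top)).norm
    exact (continuous_const.add continuous_norm).rpow_const fun x =>
      Or.inl (add_pos_of_pos_of_nonneg one_pos (norm_nonneg x)).ne'
  obtain ⟨C, hC⟩ := hcont.bounded_above_of_compact_support (hsupp.iteratedFDeriv k).norm.mul_left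
  refine ⟨C, fun x => ?_⟩
  have h := (le_abs_self _).trans (hC x)
  have hpos : 0 < (1 + ‖x‖) ^ (s - k) := by positivity
  rw [Real.rpow_neg (by positivity), inv_mul_le_iff₀ hpos, mul_comm] at h
  exact h

end SymbolBound

end SymbolBound

section Homogeneous

variable {d : ℕ} {χ : EuclideanSpace ℝ (Fin d) → ℝ} {h : EuclideanSpace ℝ (Fin d) → ℂ} {a : ℂ}

lemma isOpen_ne_zero : IsOpen {x : EuclideanSpace ℝ (Fin d) | x ≠ 0} := isOpen_ne

lemma IsCutoff.contDiff_mul (hχ : IsCutoff χ)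
    (hh : ContDiffOn ℝ (⊤ : ℕ∞) h {x : EuclideanSpace ℝ (Fin d) | x ≠ 0}) :
    ContDiff ℝ (⊤ : ℕ∞) (fun y => (χ y : ℂ) * h y) := by
  rw [contDiff_iff_contDiffAt]
  intro x
  by_cases hx : x = 0
  · obtain ⟨ε, hε, hzero⟩ := hχ.eq_zero_near
    refine (contDiffAt_const (c := (0 : ℂ))).congr_of_eventuallyEq ?_
    filter_upwards [Metric.ball_mem_nhds x hε] with y hy
    rw [hzero y (by simpa [hx] using hy)]
    simp
  · exact (Complex.ofRealCLM.contDiff.comp hχ.smooth).contDiffAt.mul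
      (hh.contDiffAt (isOpen_ne_zero.mem_nhds hx))

lemma ContDiffOn.pderiv'
    (hh : ContDiffOn ℝ (⊤ : ℕ∞) h {x : EuclideanSpace ℝ (Fin d) | x ≠ 0}) (i : Fin d) :
    ContDiffOn ℝ (⊤ : ℕ∞) (pderiv' i h) {x : EuclideanSpace ℝ (Fin d) | x ≠ 0} :=
  (hh.fderiv_of_isOpen isOpen_ne_zero (by simp)).clm_apply contDiffOn_const

lemma differentiableAt_of_contDiffOn_ne_zero
    (hh : ContDiffOn ℝ (⊤ : ℕ∞) h {x : EuclideanSpace ℝ (Fin d) | x ≠ 0})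
    {x : EuclideanSpace ℝ (Fin d)} (hx : x ≠ 0) : DifferentiableAt ℝ h x :=
  (hh.contDiffAt (isOpen_ne_zero.mem_nhds hx)).differentiableAt (by simp)

lemma pderiv'_smul_of_homog
    (hh : ContDiffOn ℝ (⊤ : ℕ∞) h {x : EuclideanSpace ℝ (Fin d) | x ≠ 0})
    (hom : ∀ t : ℝ, 0 < t → ∀ x : EuclideanSpace ℝ (Fin d), x ≠ 0 →
      h (t • x) = (t : ℂ) ^ a * h x) (i : Fin d)
    {t : ℝ} (ht : 0 < t) {x : EuclideanSpace ℝ (Fin d)} (hx : x ≠ 0) :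
    pderiv' i h (t • x) = (t : ℂ) ^ (a - 1) * pderiv' i h x := by
  have htx : t • x ≠ 0 := smul_ne_zero ht.ne' hx
  have h1 : HasFDerivAt (fun y => h (t • y))
      ((fderiv ℝ h (t • x)).comp (t • ContinuousLinearMap.id ℝ (EuclideanSpace ℝ (Fin d)))) x :=
    (differentiableAt_of_contDiffOn_ne_zero hh htx).hasFDerivAt.comp x
      ((hasFDerivAt_id x).const_smul t)
  have h2 : HasFDerivAt (fun y => (t : ℂ) ^ a * h y) ((t : ℂ) ^ a • fderiv ℝ h x) x :=
    (differentiableAt_of_contDiffOn_ne_zero hh hx).hasFDerivAt.const_mul _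
  have heq : (fun y => h (t • y)) =ᶠ[𝓝 x] fun y => (t : ℂ) ^ a * h y := by
    filter_upwards [isOpen_ne_zero.mem_nhds hx] with y hy using hom t ht y hy
  have h3 := h1.unique (h2.congr_of_eventuallyEq heq)
  have h4 := congrArg (fun L : EuclideanSpace ℝ (Fin d) →L[ℝ] ℂ =>
    L (EuclideanSpace.single i 1)) h3
  have htC : (t : ℂ) ≠ 0 := by exact_mod_cast ht.ne'
  simp only [ContinuousLinearMap.comp_apply, _root_.smul_apply,
    ContinuousLinearMap.id_apply, map_smul, smul_eq_mul, Complex.real_smul] at h4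
  unfold pderiv'
  rw [Complex.cpow_sub _ _ htC, Complex.cpow_one, div_mul_eq_mul_div, eq_div_iff htC, ← h4]
  ring

lemma fderiv_apply_self_of_homog
    (hh : ContDiffOn ℝ (⊤ : ℕ∞) h {x : EuclideanSpace ℝ (Fin d) | x ≠ 0})
    (hom : ∀ t : ℝ, 0 < t → ∀ x : EuclideanSpace ℝ (Fin d), x ≠ 0 →
      h (t • x) = (t : ℂ) ^ a * h x)
    {x : EuclideanSpace ℝ (Fin d)} (hx : x ≠ 0) : fderiv ℝ h x x = a * h x := by
  have h1 : HasDerivAt (fun t : ℝ => h (t • x)) (fderiv ℝ h x x) 1 := by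
    have hd : HasFDerivAt h (fderiv ℝ h x) ((1 : ℝ) • x) := by
      rw [one_smul]; exact (differentiableAt_of_contDiffOn_ne_zero hh hx).hasFDerivAt
    simpa using! hd.comp_hasDerivAt (1 : ℝ) ((hasDerivAt_id (1 : ℝ)).smul_const x)
  have h2 : HasDerivAt (fun t : ℝ => (t : ℂ) ^ a * h x) (a * h x) 1 := by
    have := ((hasDerivAt_id ((1 : ℝ) : ℂ)).cpow_const (c := a) (by simp)).comp_ofReal
    simpa using! this.mul_const (h x)
  refine h1.unique (h2.congr_of_eventuallyEq ?_)
  filter_upwards [lt_mem_nhds one_pos] with t ht using hom t ht x hx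

/-- Euler's identity in divergence form for a homogeneous function of degree `a`. -/
lemma sum_pderiv'_coord_mul_of_homog
    (hh : ContDiffOn ℝ (⊤ : ℕ∞) h {x : EuclideanSpace ℝ (Fin d) | x ≠ 0})
    (hom : ∀ t : ℝ, 0 < t → ∀ x : EuclideanSpace ℝ (Fin d), x ≠ 0 →
      h (t • x) = (t : ℂ) ^ a * h x) (c : ℂ)
    {x : EuclideanSpace ℝ (Fin d)} (hx : x ≠ 0) :
    ∑ i, pderiv' i (fun y => c * ((y i : ℝ) : ℂ) * h y) x = c * (a + d) * h x := by
  have hterm : ∀ i, pderiv' i (fun y => c * ((y i : ℝ) : ℂ) * h y) x =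
      c * (h x + fderiv ℝ h x (x i • EuclideanSpace.single i (1 : ℝ))) := by
    intro i
    have hc : HasFDerivAt (fun y : EuclideanSpace ℝ (Fin d) => ((y i : ℝ) : ℂ))
        (Complex.ofRealCLM.comp
          (EuclideanSpace.proj i : EuclideanSpace ℝ (Fin d) →L[ℝ] ℝ)) x :=
      (Complex.ofRealCLM.comp
          (EuclideanSpace.proj i : EuclideanSpace ℝ (Fin d) →L[ℝ] ℝ)).hasFDerivAt
    have := (hc.const_mul c).fun_mul (differentiableAt_of_contDiffOn_ne_zero hh hx).hasFDerivAt
    unfold pderiv'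
    rw [HasFDerivAt.fderiv this]
    simp
    ring
  have hsum : ∑ i, x i • EuclideanSpace.single i (1 : ℝ) = x := by
    simpa using (EuclideanSpace.basisFun (Fin d) ℝ).sum_repr x
  simp_rw [hterm]
  rw [← Finset.mul_sum, Finset.sum_add_distrib, ← map_sum, hsum,
    fderiv_apply_self_of_homog hh hom hx]
  simp
  ring

end Homogeneous

section ClassicalSymbol

variable {d : ℕ} {χ : EuclideanSpace ℝ (Fin d) → ℝ} {a : ℂ}
  {σ τ : EuclideanSpace ℝ (Fin d) → ℂ} {σh τh : ℕ → EuclideanSpace ℝ (Fin d) → ℂ}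

namespace IsClassicalSymbol

lemma symbolBound (hχ : IsCutoff χ) (hσ : IsClassicalSymbol χ a σ σh) (N : ℕ) :
    SymbolBound (a.re - N) (fun y => σ y - ∑ j ∈ Finset.range N, (χ y : ℂ) * σh j y) :=
  ⟨hσ.smooth.sub (ContDiff.sum fun j _ => hχ.contDiff_mul (hσ.smooth_homog j)), hσ.estimate N⟩

lemma of_symbolBound
    (hsmooth : ∀ j : ℕ, ContDiffOn ℝ (⊤ : ℕ∞) (σh j) {x : EuclideanSpace ℝ (Fin d) | x ≠ 0})
    (homog : ∀ j : ℕ, ∀ t : ℝ, 0 < t → ∀ x : EuclideanSpace ℝ (Fin d), x ≠ 0 →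
      σh j (t • x) = (t : ℂ) ^ (a - (j : ℂ)) * σh j x)
    (hb : ∀ N : ℕ, SymbolBound (a.re - N)
      (fun y => σ y - ∑ j ∈ Finset.range N, (χ y : ℂ) * σh j y)) :
    IsClassicalSymbol χ a σ σh :=
  ⟨by simpa using (hb 0).smooth, hsmooth, homog, fun N => (hb N).bound⟩

lemma symbolBound_leading (hχ : IsCutoff χ) (hσ : IsClassicalSymbol χ a σ σh) :
    SymbolBound a.re (fun y => (χ y : ℂ) * σh 0 y) := by
  have h0 : SymbolBound a.re σ := by simpa using hσ.symbolBound hχ 0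
  have h1 := (hσ.symbolBound hχ 1).mono (t := a.re) (by simp)
  convert h0.sub h1 using 1
  ext y
  simp

lemma sub (hχ : IsCutoff χ) (hσ : IsClassicalSymbol χ a σ σh) (hτ : IsClassicalSymbol χ a τ τh) :
    IsClassicalSymbol χ a (σ - τ) (σh - τh) := by
  refine of_symbolBound (fun j => (hσ.smooth_homog j).sub (hτ.smooth_homog j))
    (fun j t ht x hx => ?_) fun N => ?_
  · simp only [Pi.sub_apply, hσ.homog j t ht x hx, hτ.homog j t ht x hx, mul_sub]
  · convert (hσ.symbolBound hχ N).sub (hτ.symbolBound hχ N) using 1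
    ext y
    simp only [Pi.sub_apply, mul_sub, Finset.sum_sub_distrib]
    ring

lemma pderiv (hχ : IsCutoff χ) (hσ : IsClassicalSymbol χ a σ σh) (i : Fin d) :
    IsClassicalSymbol χ (a - 1) (pderiv' i σ) (fun j => pderiv' i (σh j)) := by
  refine of_symbolBound (fun j => (hσ.smooth_homog j).pderiv' i) (fun j t ht x hx => ?_)
    fun N => ?_
  · rw [pderiv'_smul_of_homog (hσ.smooth_homog j) (hσ.homog j) i ht hx]
    ring_nf
  · have hcomm : ∀ j, SymbolBound ((a - 1).re - N)
        (pderiv' i (fun y => (χ y : ℂ) * σh j y) - fun y => (χ y : ℂ) * pderiv' i (σh j) y) := by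
      intro j
      have hs := hχ.contDiff_mul (hσ.smooth_homog j)
      have hs' : ContDiff ℝ (⊤ : ℕ∞) (pderiv' i (fun y => (χ y : ℂ) * σh j y)) :=
        (hs.fderiv_right (by simp)).clm_apply contDiff_const
      refine SymbolBound.of_eq_zero
        (hs'.sub (hχ.contDiff_mul ((hσ.smooth_homog j).pderiv' i))) fun x hx => ?_
      have heq : (fun y => (χ y : ℂ) * σh j y) =ᶠ[𝓝 x] σh j := by
        filter_upwards [continuous_norm.continuousAt.eventually (lt_mem_nhds hx)] with y hy
        rw [hχ.eq_one_far y hy.le]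
        simp
      simp only [Pi.sub_apply, pderiv', heq.fderiv_eq, hχ.eq_one_far x hx.le]
      simp
    have hmain : SymbolBound ((a - 1).re - N)
        (pderiv' i (fun y => σ y - ∑ j ∈ Finset.range N, (χ y : ℂ) * σh j y)) := by
      convert (hσ.symbolBound hχ N).pderiv i using 1
      simp
      ring
    convert hmain.add (SymbolBound.sum (Finset.range N) fun j _ => hcomm j) using 1
    ext x
    have hd : ∀ j ∈ Finset.range N, DifferentiableAt ℝ (fun y => (χ y : ℂ) * σh j y) x :=
      fun j _ => (hχ.contDiff_mul (hσ.smooth_homog j)).contDiffAt.differentiableAt (by simp)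
    have hexp : pderiv' i (fun y => σ y - ∑ j ∈ Finset.range N, (χ y : ℂ) * σh j y) x =
        pderiv' i σ x - ∑ j ∈ Finset.range N, pderiv' i (fun y => (χ y : ℂ) * σh j y) x := by
      unfold pderiv'
      rw [fderiv_fun_sub (hσ.smooth.contDiffAt.differentiableAt (by simp))
        (DifferentiableAt.fun_sum hd), fderiv_fun_sum hd]
      simp
    simp only [Pi.add_apply, Finset.sum_apply, Pi.sub_apply, Finset.sum_sub_distrib, hexp]
    ring

/-- A classical symbol whose leading component vanishes has order lowered by one. -/
lemma tail (hχ : IsCutoff χ) (hσ : IsClassicalSymbol χ a σ σh) (h0 : ∀ x ≠ 0, σh 0 x = 0) :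
    IsClassicalSymbol χ (a - 1) σ (fun j => σh (j + 1)) := by
  refine of_symbolBound (fun j => hσ.smooth_homog (j + 1)) (fun j t ht x hx => ?_) fun N => ?_
  · rw [hσ.homog (j + 1) t ht x hx]
    push_cast
    ring_nf
  · have hz : ∀ y, (χ y : ℂ) * σh 0 y = 0 := by
      intro y
      by_cases hy : y = 0
      · obtain ⟨ε, hε, hzero⟩ := hχ.eq_zero_near
        rw [hzero y (by simpa [hy] using hε)]
        simp
      · rw [h0 y hy, mul_zero]
    convert hσ.symbolBound hχ (N + 1) using 1
    · simp
      ring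
    · ext y
      rw [Finset.sum_range_succ', hz, add_zero]

/-- The symbol `χ h` with a single homogeneous component. -/
lemma single {h : EuclideanSpace ℝ (Fin d) → ℂ}
    (hh : ContDiffOn ℝ (⊤ : ℕ∞) h {x : EuclideanSpace ℝ (Fin d) | x ≠ 0})
    (hom : ∀ t : ℝ, 0 < t → ∀ x : EuclideanSpace ℝ (Fin d), x ≠ 0 →
      h (t • x) = (t : ℂ) ^ a * h x)
    (hb : SymbolBound a.re (fun y => (χ y : ℂ) * h y)) :
    IsClassicalSymbol χ a (fun y => (χ y : ℂ) * h y) (fun j => if j = 0 then h else 0) := by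
  refine of_symbolBound (fun j => ?_) (fun j t ht x hx => ?_) fun N => ?_
  · split_ifs
    exacts [hh, contDiffOn_const]
  · split_ifs with hj
    · simpa [hj] using hom t ht x hx
    · simp
  · rcases N with _ | N
    · simpa using hb
    · convert SymbolBound.zero using 1
      ext y
      rw [Finset.sum_range_succ']
      simp

end IsClassicalSymbol

lemma isClassicalSymbol_sub_sum (hχ : IsCutoff χ) (hσ : IsClassicalSymbol χ a σ σh) {ι : Type*}
    (S : Finset ι) {D : ι → EuclideanSpace ℝ (Fin d) → ℂ}
    {Dh : ι → ℕ → EuclideanSpace ℝ (Fin d) → ℂ} (hD : ∀ i, IsClassicalSymbol χ a (D i) (Dh i)) :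
    IsClassicalSymbol χ a (σ - ∑ i ∈ S, D i) (σh - ∑ i ∈ S, Dh i) := by
  induction S using Finset.induction_on with
  | empty => simpa using hσ
  | insert i S hi ih =>
    rw [Finset.sum_insert hi, Finset.sum_insert hi, add_comm, ← sub_sub, add_comm (Dh i), ← sub_sub]
    exact ih.sub hχ (hD i)

/-- A classical symbol of order `a ≠ -d` is a sum of partial derivatives of classical symbols of
order `a + 1`, up to a classical symbol of order `a - 1`. -/
lemma IsClassicalSymbol.exists_sub_sum_pderiv (hχ : IsCutoff χ) (hσ : IsClassicalSymbol χ a σ σh)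
    (ha : a + d ≠ 0) :
    ∃ T : Fin d → EuclideanSpace ℝ (Fin d) → ℂ,
      (∀ i, IsSymbolOfOrder (a + 1) (T i)) ∧ (∀ i, IsSymbolOfOrder a (pderiv' i (T i))) ∧
      (∀ S : Finset (Fin d), IsSymbolOfOrder a (σ - ∑ i ∈ S, pderiv' i (T i))) ∧
      IsSymbolOfOrder (a - 1) (σ - ∑ i, pderiv' i (T i)) := by
  set c : ℂ := (a + d)⁻¹
  let h : Fin d → EuclideanSpace ℝ (Fin d) → ℂ := fun i y => c * ((y i : ℝ) : ℂ) * σh 0 y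
  have hom0 : ∀ t : ℝ, 0 < t → ∀ x : EuclideanSpace ℝ (Fin d), x ≠ 0 →
      σh 0 (t • x) = (t : ℂ) ^ a * σh 0 x := by simpa using hσ.homog 0
  have hT : ∀ i, IsClassicalSymbol χ (a + 1) (fun y => (χ y : ℂ) * h i y)
      (fun j => if j = 0 then h i else 0) := by
    intro i
    refine IsClassicalSymbol.single ?_ (fun t ht x hx => ?_) ?_
    · exact (contDiff_const.mul (SymbolBound.coord i).smooth).contDiffOn.mul (hσ.smooth_homog 0)
    · have htC : (t : ℂ) ≠ 0 := by exact_mod_cast ht.ne'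
      simp only [h, hom0 t ht x hx, Complex.cpow_add _ _ htC, Complex.cpow_one,
        PiLp.smul_apply, smul_eq_mul, Complex.ofReal_mul]
      ring
    · convert ((SymbolBound.coord i).mul (hσ.symbolBound_leading hχ)).const_smul c using 1
      · simp [add_comm]
      · ext y
        simp only [h, Pi.smul_apply, Pi.mul_apply, smul_eq_mul]
        ring
  have hD : ∀ i, IsClassicalSymbol χ a (pderiv' i fun y => (χ y : ℂ) * h i y)
      (fun j => pderiv' i (if j = 0 then h i else 0)) := by
    intro i
    simpa using (hT i).pderiv hχ i
  have hS := fun S : Finset (Fin d) => isClassicalSymbol_sub_sum hχ hσ S hD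
  refine ⟨fun i y => (χ y : ℂ) * h i y, fun i => ⟨χ, _, hχ, hT i⟩, fun i => ⟨χ, _, hχ, hD i⟩,
    fun S => ⟨χ, _, hχ, hS S⟩, ⟨χ, _, hχ, (hS Finset.univ).tail hχ fun x hx => ?_⟩⟩
  have hE := sum_pderiv'_coord_mul_of_homog (hσ.smooth_homog 0) hom0 c hx
  simp only [Pi.sub_apply, Finset.sum_apply, if_true]
  rw [hE, inv_mul_cancel₀ ha, one_mul, sub_self]

end ClassicalSymbol

section TranslationInvariance

variable {d : ℕ} {ρ lam lam₁ lam₂ : (EuclideanSpace ℝ (Fin d) → ℂ) → ℂ}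

/-- A finite linear combination of monomials vanishing on `ℤ^d` has vanishing coefficients. -/
lemma coeff_eq_zero_of_sum_mpow_intVec_eq_zero (S : Finset (Fin d → ℕ)) (c : (Fin d → ℕ) → ℂ)
    (h : ∀ p : Fin d → ℤ, ∑ β ∈ S, c β * mpow (intVec p) β = 0) : ∀ β ∈ S, c β = 0 := by
  let P : MvPolynomial (Fin d) ℂ :=
    ∑ β ∈ S, MvPolynomial.monomial (Finsupp.equivFunOnFinite.symm β) (c β)
  have hP : P = 0 := by
    refine MvPolynomial.funext_set (fun _ => Set.range ((↑) : ℤ → ℂ))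
      (fun _ => Set.infinite_range_of_injective Int.cast_injective) fun x hx => ?_
    choose p hp using fun i => hx i (Set.mem_univ i)
    rw [map_zero, map_sum, ← h p]
    refine Finset.sum_congr rfl fun β _ => ?_
    rw [MvPolynomial.eval_monomial, Finsupp.prod_fintype _ _ (by simp)]
    simp [mpow, intVec, ← hp]
  intro β hβ
  have hcoeff := congrArg (MvPolynomial.coeff (Finsupp.equivFunOnFinite.symm β)) hP
  simpa [P, MvPolynomial.coeff_sum, MvPolynomial.coeff_monomial, hβ] using hcoeff

lemma mderiv_single (i : Fin d) (f : EuclideanSpace ℝ (Fin d) → ℂ) :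
    mderiv (Pi.single i 1) f = pderiv' i f := by
  have key : ∀ l : List (Fin d), l.Nodup →
      l.foldr (fun j g => (pderiv' j)^[(Pi.single i 1 : Fin d → ℕ) j] g) f =
        if i ∈ l then pderiv' i f else f := by
    intro l
    induction l with
    | nil => simp
    | cons j l ih =>
      intro hl
      rw [List.nodup_cons] at hl
      rw [List.foldr_cons, ih hl.2]
      by_cases hij : i = j
      · subst hij
        simp [hl.1]
      · simp [hij, Ne.symm hij]
  simpa [mderiv] using key _ (List.nodup_finRange d)

lemma RdTranslationInvariant.zdTranslationInvariant (h : RdTranslationInvariant lam ρ) :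
    ZdTranslationInvariant lam ρ :=
  fun a σ ha hσ N hN p => h a σ ha hσ N hN (intVec p)

/-- Two `ℤ^d`-translation invariant forms extending the same `ρ` agree on partial derivatives. -/
lemma ZdTranslationInvariant.apply_pderiv'_eq (h₁ : ZdTranslationInvariant lam₁ ρ)
    (h₂ : ZdTranslationInvariant lam₂ ρ) {a : ℂ} {σ : EuclideanSpace ℝ (Fin d) → ℂ}
    (ha : ∀ m : ℤ, a ≠ m) (hσ : IsSymbolOfOrder a σ) (i : Fin d) :
    lam₁ (pderiv' i σ) = lam₂ (pderiv' i σ) := by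
  obtain ⟨M, hM⟩ := exists_nat_gt (a.re + d)
  have hN : a.re + d < ((M + 1 : ℕ) : ℝ) + 1 := by push_cast; linarith
  have hzero := coeff_eq_zero_of_sum_mpow_intVec_eq_zero
    ((multiLE d (M + 1)).filter (fun β => β ≠ 0))
    (fun β => (lam₁ (mderiv β σ) - lam₂ (mderiv β σ)) / mfac β) (fun p => by
      have e₁ := h₁ a σ ha hσ (M + 1) hN p
      have e₂ := h₂ a σ ha hσ (M + 1) hN p
      have e := add_right_cancel (e₁.trans e₂.symm)
      rw [← sub_eq_zero, ← Finset.sum_sub_distrib] at e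
      rw [← e]
      refine Finset.sum_congr rfl fun β _ => ?_
      ring)
  have hmem : (Pi.single i 1 : Fin d → ℕ) ∈ (multiLE d (M + 1)).filter (fun β => β ≠ 0) := by
    simp only [multiLE, Finset.mem_filter, Fintype.mem_piFinset, Finset.mem_range]
    refine ⟨⟨fun j => ?_, ?_⟩, ?_⟩
    · rcases eq_or_ne j i with rfl | hj
      · simp
      · simp [hj]
    · simp [Finset.sum_pi_single']
    · simp
  have := hzero _ hmem
  have hfac : mfac (Pi.single i 1 : Fin d → ℕ) ≠ 0 :=
    Finset.prod_ne_zero_iff.mpr fun j _ => Nat.cast_ne_zero.mpr (Nat.factorial_ne_zero _)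
  rw [mderiv_single, div_eq_zero_iff, or_iff_left hfac, sub_eq_zero] at this
  exact this

end TranslationInvariance

/-- **Uniqueness of translation invariant linear extensions:** two linear forms on
`CS^{∉ℤ}(ℝ^d)` which coincide with the same `ρ` on `CS^{∉ℤ} ∩ CS^{<−d}` and are both
`ℤ^d`-translation invariant, or both `ℝ^d`-translation invariant, agree on all of
`CS^{∉ℤ}(ℝ^d)`. -/
theorem translation_invariant_extension_unique {d : ℕ}
    (ρ lam₁ lam₂ : (EuclideanSpace ℝ (Fin d) → ℂ) → ℂ)
    (hρlin : RhoLinear ρ) (hρTaylor : RhoTaylor ρ)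
    (hlin₁ : LamLinear lam₁) (hlin₂ : LamLinear lam₂)
    (hrestrict₁ : ∀ σ ∈ CSNonInt d ∩ CSNeg d, lam₁ σ = ρ σ)
    (hrestrict₂ : ∀ σ ∈ CSNonInt d ∩ CSNeg d, lam₂ σ = ρ σ)
    (hinv : (ZdTranslationInvariant lam₁ ρ ∧ ZdTranslationInvariant lam₂ ρ) ∨
      (RdTranslationInvariant lam₁ ρ ∧ RdTranslationInvariant lam₂ ρ)) :
    ∀ σ ∈ CSNonInt d, lam₁ σ = lam₂ σ := by
  have hZ : ZdTranslationInvariant lam₁ ρ ∧ ZdTranslationInvariant lam₂ ρ :=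
    hinv.elim id fun h => ⟨h.1.zdTranslationInvariant, h.2.zdTranslationInvariant⟩
  have key : ∀ (n : ℕ) (a : ℂ) (σ : EuclideanSpace ℝ (Fin d) → ℂ), (∀ m : ℤ, a ≠ m) →
      IsSymbolOfOrder a σ → a.re < -(d : ℝ) + n → lam₁ σ = lam₂ σ := by
    intro n
    induction n with
    | zero =>
      intro a σ ha hσ hre
      have hmem : σ ∈ CSNonInt d ∩ CSNeg d := ⟨⟨a, ha, hσ⟩, a, by simpa using hre, hσ⟩
      rw [hrestrict₁ σ hmem, hrestrict₂ σ hmem]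
    | succ n ih =>
      intro a σ ha hσ hre
      have hshift : ∀ k m : ℤ, a + k ≠ m := fun k m h =>
        ha (m - k) (by push_cast; exact eq_sub_of_add_eq h)
      obtain ⟨χ, σh, hχ, hcl⟩ := hσ
      obtain ⟨T, hT, hD, hS, htail⟩ := hcl.exists_sub_sum_pderiv hχ
        (by simpa using hshift d 0)
      have hrem : ∀ S : Finset (Fin d), lam₁ σ - lam₂ σ =
          lam₁ (σ - ∑ i ∈ S, pderiv' i (T i)) - lam₂ (σ - ∑ i ∈ S, pderiv' i (T i)) := by
        intro S
        induction S using Finset.induction_on with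
        | empty => simp
        | insert i S hi ihS =>
          have hsplit : σ - ∑ j ∈ S, pderiv' j (T j) =
              (1 : ℂ) • pderiv' i (T i) + (σ - ∑ j ∈ insert i S, pderiv' j (T j)) := by
            rw [Finset.sum_insert hi, one_smul]
            abel
          have hDi : pderiv' i (T i) ∈ CSNonInt d := ⟨a, ha, hD i⟩
          have hins : σ - ∑ j ∈ insert i S, pderiv' j (T j) ∈ CSNonInt d := ⟨a, ha, hS _⟩
          have hsum : (1 : ℂ) • pderiv' i (T i) + (σ - ∑ j ∈ insert i S, pderiv' j (T j)) ∈
              CSNonInt d := hsplit ▸ ⟨a, ha, hS S⟩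
          have hinv_i := hZ.1.apply_pderiv'_eq hZ.2 (by simpa using hshift 1) (hT i) i
          rw [ihS, hsplit, hlin₁ _ _ _ hDi hins hsum, hlin₂ _ _ _ hDi hins hsum, hinv_i]
          ring
      have hlast := ih (a - 1) _ (by simpa [sub_eq_add_neg] using hshift (-1)) htail
        (by simp only [Complex.sub_re, Complex.one_re]; push_cast at hre; linarith)
      rw [← sub_eq_zero, hrem Finset.univ, hlast, sub_self]
  rintro σ ⟨a, ha, hσ⟩
  obtain ⟨n, hn⟩ := exists_nat_gt (a.re + d)
  exact key n a σ ha hσ (by linarith)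
end
end

section
/- Let σ be a classical symbol of order a on ℝ^d with a ∉ ℤ, and let p ∈ ℤ^d. Suppose constants (c_j)_{j∈ℕ}, S satisfy lim_{N→∞} ( Σ_{n∈ℤ^d, |n|_∞ ≤ N} σ(n) − Σ_{j<J} c_j N^{a+d−j} ) = S for every integer J > Re(a)+d (N running over positive integers), and constants (c'_j)_{j∈ℕ}, S' satisfy the analogous condition for the translated symbol σ(·+p). Then S' = S: the Hadamard finite part of the lattice sums of a non-integer order classical symbol over expanded hypercubes is ℤ^d-translation invariant. -/
open MeasureTheory Filter Finset Complex Metric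
open scoped Topology Pointwise Classical

noncomputable section

/-- The lattice points `n ∈ ℤ^d` with `|n|_∞ ≤ N`. -/
noncomputable def latticeBox (d N : ℕ) : Finset (Fin d → ℤ) :=
  Fintype.piFinset fun _ : Fin d => Finset.Icc (-(N : ℤ)) (N : ℤ)

/-- A sequence annihilated, up to an error tending to `0`, by finitely many of the operators
`g ↦ (N ↦ g (m N + h) - μ g N)` with `m = 2 h + 1` odd and `μ ≠ 1`. Under `M = 2 N + 1` the
substitution `N ↦ m N + h` is the dilation `M ↦ m M`. -/
inductive DilationNull : (ℕ → ℂ) → Prop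
  | of_tendsto (g : ℕ → ℂ) (hg : Tendsto g atTop (𝓝 0)) : DilationNull g
  | of_step (g : ℕ → ℂ) (h : ℕ) (μ : ℂ) (hμ : μ ≠ 1)
      (hg : DilationNull fun N => g ((2 * h + 1) * N + h) - μ * g N) : DilationNull g

lemma tendsto_odd_dilation_atTop (h : ℕ) :
    Tendsto (fun N : ℕ => (2 * h + 1) * N + h) atTop atTop :=
  tendsto_atTop_mono (fun N => by simp only [id]; nlinarith [Nat.zero_le (h * N)]) tendsto_id

namespace DilationNull

lemma congr' {g : ℕ → ℂ} (hg : DilationNull g) :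
    ∀ {g' : ℕ → ℂ}, g =ᶠ[atTop] g' → DilationNull g' := by
  induction hg with
  | of_tendsto g hg => exact fun h => of_tendsto _ (hg.congr' h)
  | of_step g h μ hμ _ ih =>
    intro g' hgg'
    refine of_step _ h μ hμ (ih ?_)
    filter_upwards [hgg', (tendsto_odd_dilation_atTop h).eventually hgg'] with N h₁ h₂
    rw [h₁, h₂]

lemma dilate {g : ℕ → ℂ} (hg : DilationNull g) (h : ℕ) (μ : ℂ) :
    DilationNull fun N => g ((2 * h + 1) * N + h) - μ * g N := by
  induction hg with
  | of_tendsto g hg =>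
    refine of_tendsto _ ?_
    simpa using (hg.comp (tendsto_odd_dilation_atTop h)).sub (hg.const_mul μ)
  | of_step g h' μ' hμ' _ ih =>
    refine of_step _ h' μ' hμ' ?_
    convert ih using 2 with N
    have : (2 * h + 1) * ((2 * h' + 1) * N + h') + h
        = (2 * h' + 1) * ((2 * h + 1) * N + h) + h' := by ring
    rw [this]
    ring

lemma const_mul {g : ℕ → ℂ} (hg : DilationNull g) (c : ℂ) : DilationNull fun N => c * g N := by
  induction hg with
  | of_tendsto g hg => exact of_tendsto _ (by simpa using hg.const_mul c)
  | of_step g h μ hμ _ ih =>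
    refine of_step _ h μ hμ ?_
    convert ih using 2 with N
    ring

lemma add {g g' : ℕ → ℂ} (hg : DilationNull g) (hg' : DilationNull g') :
    DilationNull fun N => g N + g' N := by
  induction hg generalizing g' with
  | of_tendsto g hg =>
    induction hg' generalizing g with
    | of_tendsto g' hg' => exact of_tendsto _ (by simpa using hg.add hg')
    | of_step g' h μ hμ _ ih =>
      refine of_step _ h μ hμ ?_
      have := ih (fun N => g ((2 * h + 1) * N + h) - μ * g N)
        (by simpa using (hg.comp (tendsto_odd_dilation_atTop h)).sub (hg.const_mul μ))
      convert this using 2 with N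
      ring
  | of_step g h μ hμ _ ih =>
    refine of_step _ h μ hμ ?_
    convert ih (hg'.dilate h μ) using 2 with N
    ring

lemma sub {g g' : ℕ → ℂ} (hg : DilationNull g) (hg' : DilationNull g') :
    DilationNull fun N => g N - g' N := by
  convert hg.add (hg'.const_mul (-1)) using 2 with N
  ring

lemma sum {ι : Type*} (s : Finset ι) (g : ι → ℕ → ℂ) (hg : ∀ i ∈ s, DilationNull (g i)) :
    DilationNull fun N => ∑ i ∈ s, g i N := by
  induction s using Finset.induction_on with
  | empty => exact of_tendsto _ (by simp)
  | insert i s hi ih =>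
    simp only [Finset.sum_insert hi]
    exact (hg i (by simp)).add (ih fun j hj => hg j (by simp [hj]))

lemma eq_zero_of_tendsto {g : ℕ → ℂ} (hg : DilationNull g) {L : ℂ}
    (hL : Tendsto g atTop (𝓝 L)) : L = 0 := by
  induction hg generalizing L with
  | of_tendsto g hg => exact tendsto_nhds_unique hL hg
  | of_step g h μ hμ _ ih =>
    have h₀ := ih ((hL.comp (tendsto_odd_dilation_atTop h)).sub (hL.const_mul μ))
    have : (1 - μ) * L = 0 := by linear_combination h₀
    exact (mul_eq_zero.1 this).resolve_left (sub_ne_zero.2 hμ.symm)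

end DilationNull

lemma exists_odd_cpow_ne_one {w : ℂ} (hw : w ≠ 0) :
    ∃ h : ℕ, ((2 * h + 1 : ℕ) : ℂ) ^ w ≠ 1 := by
  by_contra! H
  let u : ℕ → ℝ := fun h => Real.log (2 * h + 3) - Real.log (2 * h + 1)
  have hu : ∀ h, Complex.exp (w * u h) = 1 := by
    intro h
    have h₁ := H h
    have h₂ := H (h + 1)
    rw [Complex.cpow_def_of_ne_zero (Nat.cast_ne_zero.2 (Nat.succ_ne_zero _)),
      ← Complex.natCast_log] at h₁ h₂
    have e : w * u h = Real.log ((2 * (h + 1) + 1 : ℕ)) * w - Real.log ((2 * h + 1 : ℕ)) * w := by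
      simp only [u]
      push_cast
      rw [show (2 * (h + 1 : ℝ) + 1) = 2 * h + 3 by ring]
      ring
    rw [e, Complex.exp_sub, h₁, h₂, div_one]
  have hu_pos : ∀ h, 0 < u h := fun h =>
    sub_pos.2 (Real.log_lt_log (by positivity) (by linarith))
  have hu_lim : Tendsto u atTop (𝓝 0) := by
    have : Tendsto (fun h : ℕ => Real.log (1 + 2 * ((2 * h + 1 : ℝ))⁻¹)) atTop (𝓝 0) := by
      have h₁ : Tendsto (fun h : ℕ => (2 * h + 1 : ℝ)) atTop atTop :=
        tendsto_atTop_add_const_right _ _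
          (tendsto_natCast_atTop_atTop.const_mul_atTop (by norm_num))
      have h₂ : Tendsto (fun h : ℕ => 1 + 2 * ((2 * h + 1 : ℝ))⁻¹) atTop (𝓝 1) := by
        simpa using (h₁.inv_tendsto_atTop.const_mul 2).const_add 1
      simpa using h₂.log one_ne_zero
    refine this.congr fun h => ?_
    simp only [u]
    rw [← Real.log_div (by positivity) (by positivity)]
    congr 1
    field_simp
    ring
  have hlim : Tendsto (fun h => ‖w * u h‖) atTop (𝓝 0) := by
    have := ((Complex.continuous_ofReal.tendsto 0).comp hu_lim).const_mul w
    simpa using this.norm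
  obtain ⟨h, hh⟩ := (hlim.eventually (gt_mem_nhds Real.two_pi_pos)).exists
  obtain ⟨n, hn⟩ := Complex.exp_eq_one_iff.1 (hu h)
  have hn0 : n ≠ 0 := by
    rintro rfl
    simp [hw, (hu_pos h).ne'] at hn
  rw [hn] at hh
  have h1 : (1 : ℝ) ≤ |(n : ℝ)| := by exact_mod_cast Int.one_le_abs hn0
  have h2 : ‖(n : ℂ) * (2 * Real.pi * I)‖ = |(n : ℝ)| * (2 * Real.pi) := by
    simp [abs_of_pos Real.pi_pos]
  rw [h2] at hh
  nlinarith [Real.two_pi_pos]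

section Functionals

variable {E : Type*} [NormedAddCommGroup E]

/-- The functional `ν` is controlled by the supremum over the ball of radius `R`. -/
def IsBoundedOnBall (ν : (E → ℂ) →ₗ[ℂ] ℂ) (R C : ℝ) : Prop :=
  ∀ (G : E → ℂ) (B : ℝ), (∀ v, ‖v‖ ≤ R → ‖G v‖ ≤ B) → ‖ν G‖ ≤ C * B

lemma IsBoundedOnBall.map_congr {ν : (E → ℂ) →ₗ[ℂ] ℂ} {R C : ℝ} (hν : IsBoundedOnBall ν R C)
    {G G' : E → ℂ} (h : ∀ v, ‖v‖ ≤ R → G v = G' v) : ν G = ν G' := by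
  have := hν (G - G') 0 fun v hv => by simp [h v hv]
  rw [mul_zero, norm_le_zero_iff, map_sub, sub_eq_zero] at this
  exact this

variable [NormedSpace ℝ E]

lemma exists_taylor_bound_annulus [ProperSpace E] {f : E → ℂ}
    (hf : ContDiffOn ℝ (⊤ : ℕ∞) f {x | x ≠ 0}) (K : ℕ) (Y : ℝ) :
    ∃ B : ℝ, 0 ≤ B ∧ ∀ y w : E, 2 ≤ ‖y‖ → ‖y‖ ≤ Y → ‖w‖ ≤ 1 →
      ‖f (y + w) - ∑ k ∈ Finset.range K,
        (k.factorial : ℝ)⁻¹ • iteratedFDeriv ℝ k f y (fun _ => w)‖ ≤ B * ‖w‖ ^ K := by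
  have hat : ∀ x : E, x ≠ 0 → ContDiffAt ℝ (⊤ : ℕ∞) f x := fun x hx =>
    hf.contDiffAt (isOpen_ne.mem_nhds hx)
  let S : Set E := closedBall 0 (Y + 1) \ ball 0 1
  have hS : IsCompact S := (isCompact_closedBall _ _).diff isOpen_ball
  have hS0 : ∀ x ∈ S, x ≠ 0 := by
    rintro x hx rfl
    exact hx.2 (by simp)
  have hcont : ContinuousOn (iteratedFDeriv ℝ K f) S := fun x hx =>
    ((hat x (hS0 x hx)).iteratedFDeriv_right (m := 0) (i := K)
      (by simpa using by exact_mod_cast le_top)).continuousAt.continuousWithinAt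
  obtain ⟨B, hB⟩ := hS.exists_bound_of_continuousOn hcont
  have hmem : ∀ y w : E, 2 ≤ ‖y‖ → ‖y‖ ≤ Y → ‖w‖ ≤ 1 → y + w ∈ S := by
    intro y w h₁ h₂ h₃
    have h₄ := norm_add_le y w
    have h₅ := norm_sub_le (y + w) w
    rw [add_sub_cancel_right] at h₅
    simp only [S, Set.mem_sdiff, mem_closedBall, mem_ball, dist_zero_right, not_lt]
    constructor <;> linarith
  refine ⟨max B 0, le_max_right _ _, fun y w h₁ h₂ h₃ => ?_⟩
  have hseg : ∀ t ∈ Set.Icc (0 : ℝ) 1, y + t • w ∈ S := fun t ht =>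
    hmem y _ h₁ h₂ (by
      rw [norm_smul, Real.norm_of_nonneg ht.1]
      exact mul_le_one₀ ht.2 (norm_nonneg _) h₃)
  have hder : ∀ t ∈ Set.Icc (0 : ℝ) 1,
      ‖iteratedFDeriv ℝ K f (y + t • w) (fun _ => w)‖ ≤ max B 0 * ‖w‖ ^ K := fun t ht => by
    refine (ContinuousMultilinearMap.le_opNorm _ _).trans ?_
    simp only [Finset.prod_const, Finset.card_univ, Fintype.card_fin]
    gcongr
    exact (hB _ (hseg t ht)).trans (le_max_left _ _)
  cases K with
  | zero => simpa using hder 1 (by simp)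
  | succ n =>
    rw [map_add_eq_sum_add_integral_iteratedFDeriv (n := n) fun t ht =>
      (hat _ (hS0 _ (hseg t ht))).of_le (by exact_mod_cast le_top), add_sub_cancel_left, norm_smul]
    have hint : ‖∫ t in (0 : ℝ)..1, (1 - t) ^ n • iteratedFDeriv ℝ (n + 1) f (y + t • w)
        (fun _ => w)‖ ≤ (max B 0 * ‖w‖ ^ (n + 1)) * |1 - 0| := by
      refine intervalIntegral.norm_integral_le_of_norm_le_const fun t ht => ?_
      rw [Set.uIoc_of_le zero_le_one] at ht
      rw [norm_smul, norm_pow, Real.norm_of_nonneg (by linarith [ht.2])]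
      have := hder t ⟨ht.1.le, ht.2⟩
      have h' : (1 - t) ^ n ≤ 1 := pow_le_one₀ (by linarith [ht.2]) (by linarith [ht.1])
      have h'' : 0 ≤ (1 - t) ^ n := pow_nonneg (by linarith [ht.2]) _
      nlinarith [norm_nonneg (iteratedFDeriv ℝ (n + 1) f (y + t • w) (fun _ => w))]
    have hfac : ‖((n.factorial : ℝ)⁻¹)‖ ≤ 1 := by
      rw [norm_inv, RCLike.norm_natCast]
      exact inv_le_one_of_one_le₀ (by exact_mod_cast n.factorial_pos)
    rw [sub_zero, abs_one, mul_one] at hint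
    exact (mul_le_of_le_one_left (norm_nonneg _) hfac).trans hint

/-- The functional `ν` vanishes on homogeneous polynomials of degree `< K`. -/
def KillsDegreeLT (ν : (E → ℂ) →ₗ[ℂ] ℂ) (K : ℕ) : Prop :=
  ∀ k < K, ∀ A : MultilinearMap ℝ (fun _ : Fin k => E) ℂ, ν (fun v => A fun _ => v) = 0

/-- The functional `G ↦ c ∑ᵢ ν (v ↦ G (m⁻¹ (rᵢ + v))) - μ ν G`. -/
def refineFunctional {ι : Type*} (ν : (E → ℂ) →ₗ[ℂ] ℂ) (m : ℕ) (s : Finset ι) (r : ι → E)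
    (c μ : ℂ) : (E → ℂ) →ₗ[ℂ] ℂ :=
  c • ∑ i ∈ s, ν ∘ₗ LinearMap.funLeft ℂ ℂ (fun v => (m : ℝ)⁻¹ • (r i + v)) - μ • ν

lemma refineFunctional_apply {ι : Type*} (ν : (E → ℂ) →ₗ[ℂ] ℂ) (m : ℕ) (s : Finset ι)
    (r : ι → E) (c μ : ℂ) (G : E → ℂ) :
    refineFunctional ν m s r c μ G
      = c * ∑ i ∈ s, ν (fun v => G ((m : ℝ)⁻¹ • (r i + v))) - μ * ν G := by
  simp only [refineFunctional, LinearMap.sub_apply, LinearMap.smul_apply, LinearMap.sum_apply,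
    smul_eq_mul]
  rfl

lemma IsBoundedOnBall.exists_refine {ι : Type*} {ν : (E → ℂ) →ₗ[ℂ] ℂ} {R C : ℝ}
    (hν : IsBoundedOnBall ν R C) {m : ℕ} (hm : 0 < m) (s : Finset ι) (r : ι → E) (c μ : ℂ) :
    ∃ R' C', R ≤ R' ∧ (∀ i ∈ s, ‖r i‖ ≤ R') ∧
      IsBoundedOnBall (refineFunctional ν m s r c μ) R' C' := by
  have hsum : ∀ i ∈ s, ‖r i‖ ≤ ∑ j ∈ s, ‖r j‖ := fun i hi =>
    Finset.single_le_sum (f := fun j => ‖r j‖) (fun _ _ => norm_nonneg _) hi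
  have hpos : 0 ≤ ∑ j ∈ s, ‖r j‖ := Finset.sum_nonneg fun _ _ => norm_nonneg _
  refine ⟨∑ j ∈ s, ‖r j‖ + |R|, ‖c‖ * (s.card * C) + ‖μ‖ * C, by linarith [le_abs_self R],
    fun i hi => by linarith [hsum i hi, abs_nonneg R], fun G B hG => ?_⟩
  rw [refineFunctional_apply]
  have h₁ : ‖ν G‖ ≤ C * B := hν G B fun v hv => hG v (by linarith [le_abs_self R])
  have h₂ : ∀ i ∈ s, ‖ν (fun v => G ((m : ℝ)⁻¹ • (r i + v)))‖ ≤ C * B := fun i hi =>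
    hν _ B fun v hv => hG _ (by
      have hm1 : (m : ℝ)⁻¹ ≤ 1 := inv_le_one_of_one_le₀ (by exact_mod_cast hm)
      rw [norm_smul, norm_inv, RCLike.norm_natCast]
      refine (mul_le_of_le_one_left (norm_nonneg _) hm1).trans ((norm_add_le _ _).trans ?_)
      linarith [hsum i hi, le_abs_self R])
  calc _ ≤ ‖c‖ * ‖∑ i ∈ s, ν (fun v => G ((m : ℝ)⁻¹ • (r i + v)))‖ + ‖μ‖ * ‖ν G‖ := by
        rw [← norm_mul, ← norm_mul]
        exact norm_sub_le _ _
    _ ≤ ‖c‖ * (s.card * (C * B)) + ‖μ‖ * (C * B) := by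
        gcongr
        simpa using norm_sum_le_of_le s h₂
    _ = _ := by ring

lemma KillsDegreeLT.map_translate {ν : (E → ℂ) →ₗ[ℂ] ℂ} {K k : ℕ} (hν : KillsDegreeLT ν K)
    (hk : k ≤ K) (A : MultilinearMap ℝ (fun _ : Fin k => E) ℂ) (r : E) :
    ν (fun v => A fun _ => r + v) = ν (fun v => A fun _ => v) := by
  have key : (fun v => A fun _ => r + v) = ∑ s : Finset (Fin k),
      fun v => A (s.piecewise (fun _ => r) fun _ => v) := by
    ext v
    rw [Finset.sum_apply]
    exact A.map_add_univ (fun _ => r) fun _ => v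
  rw [key, map_sum, Finset.sum_eq_single ∅]
  · simp
  · intro s _ hs
    have hcard : sᶜ.card < k := by
      rw [Finset.card_compl, Fintype.card_fin]
      have := Finset.card_pos.2 (Finset.nonempty_iff_ne_empty.2 hs)
      have := Finset.card_le_univ s
      rw [Fintype.card_fin] at this
      omega
    convert hν _ (hcard.trans_le hk) (A.restr sᶜ rfl r) using 2
    ext v
    simp only [MultilinearMap.restr, MultilinearMap.coe_mk]
    congr 1
    ext j
    by_cases hj : j ∈ s <;> simp [hj]
  · simp

lemma KillsDegreeLT.refine {ι : Type*} {ν : (E → ℂ) →ₗ[ℂ] ℂ} {K : ℕ} (hν : KillsDegreeLT ν K)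
    (m : ℕ) (s : Finset ι) (r : ι → E) (c : ℂ) :
    KillsDegreeLT (refineFunctional ν m s r c (c * s.card * (m : ℂ)⁻¹ ^ K)) (K + 1) := by
  intro k hk A
  have h₁ : ∀ i ∈ s, ν (fun v => A fun _ => (m : ℝ)⁻¹ • (r i + v))
      = (m : ℂ)⁻¹ ^ k * ν (fun v => A fun _ => v) := by
    intro i _
    rw [← hν.map_translate (Nat.lt_succ_iff.1 hk) A (r i), ← smul_eq_mul, ← map_smul]
    congr 1
    ext v
    have := A.map_smul_univ (fun _ => (m : ℝ)⁻¹) fun _ => r i + v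
    rw [this]
    simp
  rw [refineFunctional_apply, Finset.sum_congr rfl h₁, Finset.sum_const, nsmul_eq_mul]
  rcases (Nat.lt_succ_iff.1 hk).lt_or_eq with h | rfl
  · rw [hν k h A]
    ring
  · ring

end Functionals

section Lattice

variable {d : ℕ}

/-- The lattice points `n` of the box `|n|_∞ ≤ N` with `nᵢ = 0`. -/
def faceBox (i : Fin d) (N : ℕ) : Finset (Fin d → ℤ) :=
  (latticeBox d N).filter fun n => n i = 0

lemma mem_latticeBox {N : ℕ} {n : Fin d → ℤ} :
    n ∈ latticeBox d N ↔ ∀ j, -(N : ℤ) ≤ n j ∧ n j ≤ N := by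
  simp [latticeBox]

lemma mem_faceBox {i : Fin d} {N : ℕ} {n : Fin d → ℤ} :
    n ∈ faceBox i N ↔ (∀ j, -(N : ℤ) ≤ n j ∧ n j ≤ N) ∧ n i = 0 := by
  simp [faceBox, mem_latticeBox]

lemma card_faceBox (i : Fin d) (N : ℕ) : (faceBox i N).card = (2 * N + 1) ^ (d - 1) := by
  have h : faceBox i N = Fintype.piFinset fun j : Fin d =>
      if j = i then ({0} : Finset ℤ) else Finset.Icc (-(N : ℤ)) N := by
    ext n
    rw [mem_faceBox, Fintype.mem_piFinset]
    constructor
    · rintro ⟨h₁, h₂⟩ j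
      split_ifs with hj
      · simp [hj, h₂]
      · simpa using h₁ j
    · intro h
      have hi : n i = 0 := by simpa using h i
      refine ⟨fun j => ?_, hi⟩
      by_cases hj : j = i
      · subst hj
        simp [hi]
      · simpa [hj] using h j
  rw [h, Fintype.card_piFinset, ← Finset.mul_prod_erase _ _ (Finset.mem_univ i),
    Finset.prod_congr rfl (g := fun _ => 2 * N + 1)]
  · simp
  · intro j hj
    rw [if_neg (Finset.ne_of_mem_erase hj), Int.card_Icc]
    omega

lemma sum_faceBox_dilate {M : Type*} [AddCommMonoid M] (i : Fin d) (h N : ℕ)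
    (G : (Fin d → ℤ) → M) :
    ∑ x ∈ faceBox i ((2 * h + 1) * N + h), G x
      = ∑ n ∈ faceBox i N, ∑ r ∈ faceBox i h, G ((2 * h + 1 : ℤ) • n + r) := by
  rw [← Finset.sum_product']
  have hm : (0 : ℤ) < 2 * h + 1 := by positivity
  symm
  refine Finset.sum_nbij' (fun q => (2 * h + 1 : ℤ) • q.1 + q.2)
    (fun x => (fun j => (x j + h) / (2 * h + 1),
      fun j => x j - (2 * h + 1) * ((x j + h) / (2 * h + 1)))) ?_ ?_ ?_ ?_ ?_
  · rintro ⟨n, r⟩ hq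
    simp only [Finset.mem_product, mem_faceBox] at hq
    rw [mem_faceBox]
    simp only [Pi.add_apply, Pi.smul_apply, smul_eq_mul]
    refine ⟨fun j => ?_, by simp [hq.1.2, hq.2.2]⟩
    have h₁ := hq.1.1 j
    have h₂ := hq.2.1 j
    push_cast
    constructor <;> nlinarith
  · intro x hx
    rw [mem_faceBox] at hx
    have hx' := fun j => hx.1 j
    push_cast at hx'
    simp only [Finset.mem_product, mem_faceBox]
    have hi : (x i + h) / (2 * h + 1 : ℤ) = 0 := by
      rw [hx.2]
      exact Int.ediv_eq_zero_of_lt (by positivity) (by omega)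
    refine ⟨⟨fun j => ⟨?_, ?_⟩, hi⟩, fun j => ?_, by rw [hi, hx.2]; simp⟩
    · rw [Int.le_ediv_iff_mul_le hm]
      linarith [(hx' j).1]
    · rw [← Int.lt_add_one_iff, Int.ediv_lt_iff_lt_mul hm]
      linarith [(hx' j).2]
    · have h₁ := Int.emod_nonneg (x j + h) hm.ne'
      have h₂ := Int.emod_lt_of_pos (x j + h) hm
      have h₃ := Int.mul_ediv_add_emod (x j + h) (2 * h + 1)
      constructor <;> linarith
  · rintro ⟨n, r⟩ hq
    simp only [Finset.mem_product, mem_faceBox] at hq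
    have key : ∀ j, ((2 * h + 1 : ℤ) * n j + r j + h) / (2 * h + 1) = n j := fun j => by
      have h₂ := hq.2.1 j
      rw [add_assoc, Int.mul_add_ediv_left _ _ hm.ne',
        Int.ediv_eq_zero_of_lt (by linarith) (by linarith), add_zero]
    ext j
    · simpa using key j
    · simp [key j]
  · intro x _
    ext j
    simp
  · intro q _
    rfl

lemma sum_latticeBox_eq_sum_faceBox {M : Type*} [AddCommMonoid M] (i : Fin d) (N : ℕ)
    (G : (Fin d → ℤ) → M) :
    ∑ x ∈ latticeBox d N, G x
      = ∑ n ∈ faceBox i N, ∑ k ∈ Finset.Icc (-(N : ℤ)) N, G (n + Pi.single i k) := by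
  rw [← Finset.sum_product']
  symm
  refine Finset.sum_nbij' (fun q => q.1 + Pi.single i q.2)
    (fun x => (Function.update x i 0, x i)) ?_ ?_ ?_ ?_ ?_
  · rintro ⟨n, k⟩ hq
    simp only [Finset.mem_product, mem_faceBox, Finset.mem_Icc] at hq
    rw [mem_latticeBox]
    intro j
    by_cases hj : j = i
    · subst hj
      simpa [hq.1.2] using hq.2
    · simpa [hj] using hq.1.1 j
  · intro x hx
    rw [mem_latticeBox] at hx
    simp only [Finset.mem_product, mem_faceBox, Finset.mem_Icc]
    refine ⟨⟨fun j => ?_, by simp⟩, hx i⟩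
    by_cases hj : j = i
    · subst hj
      simp
    · simpa [hj] using hx j
  · rintro ⟨n, k⟩ hq
    simp only [Finset.mem_product, mem_faceBox] at hq
    ext j
    · by_cases hj : j = i
      · subst hj
        simp [hq.1.2]
      · simp [hj]
    · simp [hq.1.2]
  · intro x _
    ext j
    by_cases hj : j = i
    · subst hj
      simp
    · simp [hj]
  · intro q _
    rfl

lemma sum_Icc_neg_telescope {M : Type*} [AddCommGroup M] (N : ℕ) (g : ℤ → M) :
    ∑ k ∈ Finset.Icc (-(N : ℤ)) N, (g (k + 1) - g k) = g (N + 1) - g (-N) := by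
  have h := Finset.sum_range_sub (fun j : ℕ => g (j - N)) (2 * N + 1)
  have e : ((2 * N + 1 : ℕ) : ℤ) - N = N + 1 := by
    push_cast
    ring
  simp only [e, Nat.cast_zero, zero_sub] at h
  rw [← h]
  symm
  refine Finset.sum_nbij' (fun j : ℕ => (j : ℤ) - N) (fun k : ℤ => (k + N).toNat) ?_ ?_ ?_ ?_ ?_
  · intro j hj
    rw [Finset.mem_range] at hj
    rw [Finset.mem_Icc]
    omega
  · intro k hk
    rw [Finset.mem_Icc] at hk
    rw [Finset.mem_range]
    omega
  · intro j _
    simp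
  · intro k hk
    rw [Finset.mem_Icc] at hk
    omega
  · intro j _
    push_cast
    ring_nf

lemma sum_latticeBox_shift_sub {M : Type*} [AddCommGroup M] (i : Fin d) (N : ℕ)
    (G : (Fin d → ℤ) → M) :
    ∑ n ∈ latticeBox d N, (G (n + Pi.single i 1) - G n)
      = ∑ n ∈ faceBox i N, (G (n + Pi.single i (N + 1 : ℤ)) - G (n + Pi.single i (-N : ℤ))) := by
  rw [sum_latticeBox_eq_sum_faceBox i]
  refine Finset.sum_congr rfl fun n _ => ?_
  refine Eq.trans ?_ (sum_Icc_neg_telescope N fun k => G (n + Pi.single i k))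
  refine Finset.sum_congr rfl fun k _ => ?_
  rw [add_assoc, ← Pi.single_add]

@[simp]
lemma intVec_apply (n : Fin d → ℤ) (j : Fin d) : intVec n j = n j := rfl

@[simp]
lemma intVec_zero : intVec (0 : Fin d → ℤ) = 0 := by
  ext j
  simp

lemma intVec_add (n r : Fin d → ℤ) : intVec (n + r) = intVec n + intVec r := by
  ext j
  simp

lemma intVec_smul (m : ℤ) (n : Fin d → ℤ) : intVec (m • n) = (m : ℝ) • intVec n := by
  ext j
  simp

lemma intVec_single (i : Fin d) (k : ℤ) :
    intVec (Pi.single i k) = (k : ℝ) • EuclideanSpace.single i (1 : ℝ) := by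
  ext j
  by_cases hj : j = i
  · subst hj
    simp
  · simp [hj]

/-- The point above `n` of the face `xᵢ = s (2 N + 1) / 2` of the cube of side `2 N + 1`. -/
def facePoint (i : Fin d) (s : ℝ) (N : ℕ) (n : Fin d → ℤ) : EuclideanSpace ℝ (Fin d) :=
  intVec n + (s * ((2 * N + 1) / 2)) • EuclideanSpace.single i (1 : ℝ)

lemma le_norm_facePoint {i : Fin d} {s : ℝ} (hs : |s| = 1) {N : ℕ} {n : Fin d → ℤ}
    (hn : n ∈ faceBox i N) : (2 * N + 1 : ℝ) / 2 ≤ ‖facePoint i s N n‖ := by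
  refine le_trans (le_of_eq ?_) (PiLp.norm_apply_le (facePoint i s N n) i)
  have : (0 : ℝ) < (2 * N + 1) / 2 := by positivity
  simp [facePoint, (mem_faceBox.1 hn).2, hs]
  rw [abs_of_pos (by positivity)]

lemma norm_facePoint_le {i : Fin d} {s : ℝ} (hs : |s| = 1) {N : ℕ} {n : Fin d → ℤ}
    (hn : n ∈ faceBox i N) : ‖facePoint i s N n‖ ≤ d * ((2 * N + 1 : ℝ) / 2) := by
  have hpos : (0 : ℝ) < (2 * N + 1) / 2 := by positivity
  have hj : ∀ j, ‖facePoint i s N n j‖ ≤ (2 * N + 1 : ℝ) / 2 := by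
    intro j
    by_cases hj : j = i
    · subst hj
      simp [facePoint, (mem_faceBox.1 hn).2, hs]
      rw [abs_of_pos (by positivity)]
    · have h := (mem_faceBox.1 hn).1 j
      have h' : |(n j : ℝ)| ≤ N := abs_le.2 ⟨by exact_mod_cast h.1, by exact_mod_cast h.2⟩
      simp only [facePoint, PiLp.add_apply, intVec_apply, PiLp.smul_apply]
      simp [hj]
      linarith
  have hsum : facePoint i s N n
      = ∑ j, (facePoint i s N n j) • EuclideanSpace.single j (1 : ℝ) := by
    ext k
    simp [Finset.sum_apply, Pi.single_apply]
  calc ‖facePoint i s N n‖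
      ≤ ∑ j, ‖(facePoint i s N n j) • EuclideanSpace.single j (1 : ℝ)‖ := by
        conv_lhs => rw [hsum]
        exact norm_sum_le _ _
    _ ≤ ∑ _j : Fin d, (2 * N + 1 : ℝ) / 2 := by
        refine Finset.sum_le_sum fun j _ => ?_
        simpa [norm_smul] using hj j
    _ = _ := by simp

lemma facePoint_dilate (i : Fin d) (s : ℝ) (h N : ℕ) (n r : Fin d → ℤ)
    (v : EuclideanSpace ℝ (Fin d)) :
    facePoint i s ((2 * h + 1) * N + h) ((2 * h + 1 : ℤ) • n + r) + v
      = (2 * h + 1 : ℝ) • (facePoint i s N n + (2 * h + 1 : ℝ)⁻¹ • (intVec r + v)) := by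
  have : (2 * h + 1 : ℝ) ≠ 0 := by positivity
  rw [smul_add, smul_inv_smul₀ this]
  simp only [facePoint, intVec_add, intVec_smul, smul_add, smul_smul]
  push_cast
  rw [show s * ((2 * ((2 * h + 1 : ℝ) * N + h) + 1) / 2)
    = (2 * h + 1) * (s * ((2 * N + 1) / 2)) by ring]
  abel

lemma tendsto_odd_pow_mul_rpow (A β : ℝ) (hβ : β + d < 0) :
    Tendsto (fun N : ℕ => (2 * N + 1 : ℝ) ^ (d - 1) * (A * ((2 * N + 1) / 4) ^ β))
      atTop (𝓝 0) := by
  have hM : Tendsto (fun N : ℕ => (2 * N + 1 : ℝ)) atTop atTop :=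
    tendsto_atTop_add_const_right _ _
      (tendsto_natCast_atTop_atTop.const_mul_atTop (by norm_num))
  have hexp : 0 < -(((d - 1 : ℕ) : ℝ) + β) := by
    have : ((d - 1 : ℕ) : ℝ) ≤ d := by exact_mod_cast Nat.sub_le d 1
    linarith
  have := ((tendsto_rpow_neg_atTop hexp).comp hM).const_mul (A * (1 / 4 : ℝ) ^ β)
  rw [mul_zero] at this
  refine this.congr fun N => ?_
  have hN : (0 : ℝ) < 2 * N + 1 := by positivity
  simp only [Function.comp_apply, neg_neg]
  rw [Real.rpow_add hN, Real.rpow_natCast, div_eq_mul_one_div (2 * N + 1 : ℝ) 4,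
    Real.mul_rpow hN.le (by norm_num)]
  ring

end Lattice

section Face

variable {d : ℕ} {f : EuclideanSpace ℝ (Fin d) → ℂ} {b : ℂ} {i : Fin d} {s : ℝ}
  {ν : (EuclideanSpace ℝ (Fin d) → ℂ) →ₗ[ℂ] ℂ} {R C : ℝ}

lemma tendsto_faceSum_zero
    (hf : ContDiffOn ℝ (⊤ : ℕ∞) f {x | x ≠ 0})
    (hfb : ∀ t : ℝ, 0 < t → ∀ x, x ≠ 0 → f (t • x) = (t : ℂ) ^ b * f x)
    (hs : |s| = 1) {K : ℕ} (hK : b.re + d < K) (hν : KillsDegreeLT ν K)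
    (hνb : IsBoundedOnBall ν R C) :
    Tendsto (fun N : ℕ => ∑ n ∈ faceBox i N, ν fun v => f (facePoint i s N n + v))
      atTop (𝓝 0) := by
  obtain ⟨B, hB0, hB⟩ := exists_taylor_bound_annulus hf K (2 * d)
  have hlim := tendsto_odd_pow_mul_rpow (d := d) (|C| * (B * |R| ^ K)) (b.re - K) (by linarith)
  refine squeeze_zero_norm' ?_ hlim
  have hev : ∀ᶠ N : ℕ in atTop, 4 * |R| ≤ N :=
    tendsto_natCast_atTop_atTop.eventually_ge_atTop _
  filter_upwards [hev] with N hN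
  set t : ℝ := (2 * N + 1) / 4 with ht
  have ht0 : 0 < t := by positivity
  have htR : |R| ≤ t := by
    rw [ht]
    linarith [abs_nonneg R]
  have hterm : ∀ n ∈ faceBox i N, ‖ν fun v => f (facePoint i s N n + v)‖
      ≤ |C| * (B * |R| ^ K) * t ^ (b.re - K) := by
    intro n hn
    set y := t⁻¹ • facePoint i s N n with hy
    have hyn : ‖y‖ = t⁻¹ * ‖facePoint i s N n‖ := by
      rw [hy, norm_smul, norm_inv, Real.norm_of_nonneg ht0.le]
    have hy2 : 2 ≤ ‖y‖ := by
      rw [hyn, inv_mul_eq_div, le_div_iff₀ ht0]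
      have := le_norm_facePoint hs hn
      linarith
    have hyd : ‖y‖ ≤ 2 * d := by
      rw [hyn, inv_mul_eq_div, div_le_iff₀ ht0]
      have := norm_facePoint_le hs hn
      calc _ ≤ _ := this
        _ = _ := by rw [ht]; ring
    have hsmall : ∀ v : EuclideanSpace ℝ (Fin d), ‖v‖ ≤ R → ‖t⁻¹ • v‖ ≤ 1 := by
      intro v hv
      rw [norm_smul, norm_inv, Real.norm_of_nonneg ht0.le, inv_mul_eq_div, div_le_one ht0]
      linarith [le_abs_self R]
    let P : EuclideanSpace ℝ (Fin d) → ℂ := ∑ k ∈ Finset.range K, fun v =>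
      (k.factorial : ℝ)⁻¹ • iteratedFDeriv ℝ k f y (fun _ => t⁻¹ • v)
    have hP : ν P = 0 := by
      rw [map_sum]
      refine Finset.sum_eq_zero fun k hk => ?_
      rw [← hν k (Finset.mem_range.1 hk)
        (((k.factorial : ℝ)⁻¹ * t⁻¹ ^ k) • (iteratedFDeriv ℝ k f y).toMultilinearMap)]
      congr 1
      ext v
      have := (iteratedFDeriv ℝ k f y).map_smul_univ (fun _ => t⁻¹) fun _ => v
      rw [this]
      simp [mul_assoc]
    have hscale : ν (fun v => f (facePoint i s N n + v))
        = (t : ℂ) ^ b * ν ((fun v => f (y + t⁻¹ • v)) - P) := by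
      rw [map_sub, hP, sub_zero, ← smul_eq_mul, ← map_smul]
      refine hνb.map_congr fun v hv => ?_
      have hne : y + t⁻¹ • v ≠ 0 := by
        intro h0
        have h₁ := norm_sub_le (y + t⁻¹ • v) (t⁻¹ • v)
        rw [add_sub_cancel_right, h0, norm_zero] at h₁
        linarith [hsmall v hv]
      rw [Pi.smul_apply, smul_eq_mul, ← hfb t ht0 _ hne, hy, ← smul_add, smul_inv_smul₀ ht0.ne']
    have hrem : ‖ν ((fun v => f (y + t⁻¹ • v)) - P)‖ ≤ C * (B * (t⁻¹ * |R|) ^ K) := by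
      refine hνb _ _ fun v hv => ?_
      have h₁ := hB y (t⁻¹ • v) hy2 hyd (hsmall v hv)
      simp only [P, Pi.sub_apply, Finset.sum_apply]
      refine h₁.trans ?_
      rw [norm_smul, norm_inv, Real.norm_of_nonneg ht0.le]
      gcongr
      exact hv.trans (le_abs_self R)
    rw [hscale, norm_mul, Complex.norm_cpow_eq_rpow_re_of_pos ht0]
    calc t ^ b.re * _ ≤ t ^ b.re * (|C| * (B * (t⁻¹ * |R|) ^ K)) := by
          gcongr
          refine hrem.trans ?_
          gcongr
          exact le_abs_self C
      _ = _ := by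
          rw [Real.rpow_sub ht0, Real.rpow_natCast, mul_pow, inv_pow]
          ring
  refine (norm_sum_le_of_le _ hterm).trans (le_of_eq ?_)
  rw [Finset.sum_const, card_faceBox, nsmul_eq_mul]
  push_cast
  ring

lemma dilationNull_faceSum
    (hf : ContDiffOn ℝ (⊤ : ℕ∞) f {x | x ≠ 0})
    (hfb : ∀ t : ℝ, 0 < t → ∀ x, x ≠ 0 → f (t • x) = (t : ℂ) ^ b * f x)
    (hb : ∀ m : ℤ, b ≠ m) (hs : |s| = 1) {K : ℕ} (hν : KillsDegreeLT ν K)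
    (hνb : IsBoundedOnBall ν R C) :
    DilationNull fun N => ∑ n ∈ faceBox i N, ν fun v => f (facePoint i s N n + v) := by
  obtain ⟨l, hl⟩ : ∃ l : ℕ, b.re + d < K + l := by
    obtain ⟨l, hl⟩ := exists_nat_gt (b.re + d)
    exact ⟨l, by linarith [(Nat.cast_nonneg K : (0 : ℝ) ≤ K)]⟩
  induction l generalizing K ν R C with
  | zero => exact .of_tendsto _ (tendsto_faceSum_zero hf hfb hs (by simpa using hl) hν hνb)
  | succ l ih =>
    have hw : b + ((d - 1 : ℕ) : ℂ) - K ≠ 0 := by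
      intro h0
      apply hb (K - (d - 1 : ℕ))
      push_cast
      linear_combination h0
    obtain ⟨h, hh⟩ := exists_odd_cpow_ne_one hw
    set m : ℕ := 2 * h + 1 with hm
    have hm0 : (m : ℂ) ≠ 0 := Nat.cast_ne_zero.2 (Nat.succ_ne_zero _)
    have hμ : (m : ℂ) ^ b * (faceBox i h).card * (m : ℂ)⁻¹ ^ K ≠ 1 := by
      convert hh using 1
      rw [Complex.cpow_sub _ _ hm0, Complex.cpow_add _ _ hm0, Complex.cpow_natCast,
        Complex.cpow_natCast, card_faceBox]
      push_cast [hm]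
      rw [div_eq_mul_inv, inv_pow]
    obtain ⟨R', C', hRR', hr, hb'⟩ := hνb.exists_refine (m := m) (Nat.succ_pos _) (faceBox i h)
      intVec ((m : ℂ) ^ b) ((m : ℂ) ^ b * (faceBox i h).card * (m : ℂ)⁻¹ ^ K)
    refine .of_step _ h _ hμ ?_
    refine (ih (hν.refine m (faceBox i h) intVec ((m : ℂ) ^ b)) hb'
      (by push_cast at hl ⊢; linarith)).congr' ?_
    have hev : ∀ᶠ N : ℕ in atTop, 2 * |R'| < N :=
      tendsto_natCast_atTop_atTop.eventually_gt_atTop _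
    filter_upwards [hev] with N hN
    rw [sum_faceBox_dilate, Finset.mul_sum, ← Finset.sum_sub_distrib]
    refine Finset.sum_congr rfl fun n hn => ?_
    rw [refineFunctional_apply, Finset.mul_sum]
    congr 1
    refine Finset.sum_congr rfl fun r hrm => ?_
    rw [← smul_eq_mul, ← map_smul]
    refine hνb.map_congr fun v hv => ?_
    have hcast : (m : ℝ) = 2 * h + 1 := by
      rw [hm]
      push_cast
      rfl
    have hm1 : (m : ℝ)⁻¹ ≤ 1 := inv_le_one_of_one_le₀ (by exact_mod_cast Nat.succ_pos _)
    have hne : facePoint i s N n + (m : ℝ)⁻¹ • (intVec r + v) ≠ 0 := by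
      intro h0
      have h₁ := norm_sub_le (facePoint i s N n + (m : ℝ)⁻¹ • (intVec r + v))
        ((m : ℝ)⁻¹ • (intVec r + v))
      rw [add_sub_cancel_right, h0, norm_zero, norm_smul, norm_inv, RCLike.norm_natCast] at h₁
      have h₂ := mul_le_of_le_one_left (norm_nonneg (intVec r + v)) hm1
      linarith [le_norm_facePoint hs hn, norm_add_le (intVec r) v, hr r hrm, le_abs_self R']
    rw [Pi.smul_apply, smul_eq_mul, facePoint_dilate, ← hcast,
      hfb m (by exact_mod_cast Nat.succ_pos _) _ hne, Complex.ofReal_natCast]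

end Face

lemma dilationNull_natCast_cpow {w : ℂ} (hw : ∀ m : ℤ, w ≠ m) :
    DilationNull fun N => (N : ℂ) ^ w := by
  let f : EuclideanSpace ℝ (Fin 1) → ℂ := fun x => ((‖x‖ : ℝ) : ℂ) ^ w
  have hf : ContDiffOn ℝ (⊤ : ℕ∞) f {x | x ≠ 0} := by
    have hexp : ContDiffOn ℝ (⊤ : ℕ∞) (fun x : EuclideanSpace ℝ (Fin 1) =>
        Complex.exp (((Real.log ‖x‖ : ℝ) : ℂ) * w)) {x | x ≠ 0} := by
      intro x hx
      have h₁ : ContDiffAt ℝ (⊤ : ℕ∞) (fun x : EuclideanSpace ℝ (Fin 1) => Real.log ‖x‖) x :=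
        (contDiffAt_norm ℝ hx).log (norm_ne_zero_iff.2 hx)
      exact (((Complex.ofRealCLM.contDiff.contDiffAt.comp x h₁).mul
        contDiffAt_const).cexp).contDiffWithinAt
    refine hexp.congr fun x hx => ?_
    simp only [f]
    rw [Complex.cpow_def_of_ne_zero (by simpa using hx), Complex.ofReal_log (norm_nonneg _)]
  have hfw : ∀ t : ℝ, 0 < t → ∀ x, x ≠ 0 → f (t • x) = (t : ℂ) ^ w * f x := by
    intro t ht x _
    simp only [f, norm_smul, Real.norm_of_nonneg ht.le, Complex.ofReal_mul]
    exact Complex.mul_cpow_ofReal_nonneg ht.le (norm_nonneg _) w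
  let v₀ : EuclideanSpace ℝ (Fin 1) := (-(1 / 2) : ℝ) • EuclideanSpace.single 0 1
  have := dilationNull_faceSum (i := 0) (ν := LinearMap.proj v₀) (R := ‖v₀‖) (C := 1) (K := 0)
    hf hfw hw (abs_one) (fun k hk => absurd hk (Nat.not_lt_zero k))
    (fun G B hG => by simpa using hG v₀ le_rfl)
  refine this.congr' (Eventually.of_forall fun N => ?_)
  have hbox : faceBox (0 : Fin 1) N = {0} := by
    ext n
    rw [mem_faceBox, Finset.mem_singleton, funext_iff]
    simp only [Fin.forall_fin_one, Pi.zero_apply]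
    omega
  have hpt : facePoint (0 : Fin 1) 1 N 0 + v₀ = (N : ℝ) • EuclideanSpace.single 0 1 := by
    ext j
    fin_cases j
    simp [facePoint, v₀]
    ring
  simp only [hbox, Finset.sum_singleton, LinearMap.proj_apply, hpt, f, norm_smul]
  simp

section Symbol

variable {d : ℕ} {χ : EuclideanSpace ℝ (Fin d) → ℝ} {a : ℂ} {σ : EuclideanSpace ℝ (Fin d) → ℂ}
  {σh : ℕ → EuclideanSpace ℝ (Fin d) → ℂ}

lemma IsClassicalSymbol.dilationNull_faceSum (hχ : IsCutoff χ) (ha : ∀ m : ℤ, a ≠ m)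
    (hσ : IsClassicalSymbol χ a σ σh) (i : Fin d) {s : ℝ} (hs : |s| = 1)
    (v : EuclideanSpace ℝ (Fin d)) :
    DilationNull fun N => ∑ n ∈ faceBox i N, σ (facePoint i s N n + v) := by
  obtain ⟨J, hJ⟩ := exists_nat_gt (a.re + d)
  have hmain : DilationNull fun N => ∑ j ∈ Finset.range J,
      ∑ n ∈ faceBox i N, σh j (facePoint i s N n + v) := by
    refine DilationNull.sum _ _ fun j _ => ?_
    refine _root_.dilationNull_faceSum (ν := LinearMap.proj v) (R := ‖v‖) (C := 1) (K := 0)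
      (hσ.smooth_homog j) (hσ.homog j) (fun m hm => ha (m + j) ?_) hs
      (fun k hk => absurd hk (Nat.not_lt_zero k)) (fun G B hG => by simpa using hG v le_rfl)
    push_cast
    linear_combination hm
  obtain ⟨C, hC⟩ := hσ.estimate J 0
  have hrem : Tendsto (fun N : ℕ => ∑ n ∈ faceBox i N, (σ (facePoint i s N n + v)
      - ∑ j ∈ Finset.range J, σh j (facePoint i s N n + v))) atTop (𝓝 0) := by
    refine squeeze_zero_norm' ?_ (tendsto_odd_pow_mul_rpow (d := d) |C| (a.re - J) (by linarith))
    have hev : ∀ᶠ N : ℕ in atTop, 4 * ‖v‖ + 4 ≤ N :=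
      tendsto_natCast_atTop_atTop.eventually_ge_atTop _
    filter_upwards [hev] with N hN
    have hterm : ∀ n ∈ faceBox i N, ‖σ (facePoint i s N n + v)
        - ∑ j ∈ Finset.range J, σh j (facePoint i s N n + v)‖
          ≤ |C| * ((2 * N + 1) / 4) ^ (a.re - J) := by
      intro n hn
      set x := facePoint i s N n + v
      have h₁ := norm_sub_le x v
      rw [show x - v = facePoint i s N n from add_sub_cancel_right _ _] at h₁
      have h₂ := le_norm_facePoint hs hn
      have hx : (2 * N + 1 : ℝ) / 4 ≤ ‖x‖ := by linarith [norm_nonneg v]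
      have h₃ := hC x
      rw [norm_iteratedFDeriv_zero, Nat.cast_zero, sub_zero] at h₃
      simp only [hχ.eq_one_far x (by linarith [norm_nonneg v]), Complex.ofReal_one, one_mul] at h₃
      refine h₃.trans ?_
      gcongr ?_ * ?_
      · exact le_abs_self C
      · exact Real.rpow_le_rpow_of_nonpos (by positivity) (by linarith)
          (by linarith [(Nat.cast_nonneg d : (0 : ℝ) ≤ d)])
    refine (norm_sum_le_of_le _ hterm).trans (le_of_eq ?_)
    rw [Finset.sum_const, card_faceBox, nsmul_eq_mul]
    push_cast
    ring
  refine (hmain.add (.of_tendsto _ hrem)).congr' (Eventually.of_forall fun N => ?_)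
  simp only
  rw [Finset.sum_comm, ← Finset.sum_add_distrib]
  simp

lemma IsClassicalSymbol.dilationNull_sum_translate_sub (hχ : IsCutoff χ) (ha : ∀ m : ℤ, a ≠ m)
    (hσ : IsClassicalSymbol χ a σ σh) (p : Fin d → ℤ) :
    DilationNull fun N => ∑ n ∈ latticeBox d N, σ (intVec n + intVec p)
      - ∑ n ∈ latticeBox d N, σ (intVec n) := by
  let A : (Fin d → ℤ) → ℕ → ℂ := fun q N => ∑ n ∈ latticeBox d N, σ (intVec (n + q))
  let H : AddSubgroup (Fin d → ℤ) :=
    { carrier := {p | ∀ q, DilationNull fun N => A (q + p) N - A q N}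
      zero_mem' := fun q => .of_tendsto _ (by simp)
      add_mem' := fun {p p'} hp hp' q => by
        convert (hp q).add (hp' (q + p)) using 2 with N
        rw [add_assoc]
        ring
      neg_mem' := fun {p} hp q => by
        convert (hp (q + -p)).const_mul (-1) using 2 with N
        rw [neg_add_cancel_right]
        ring }
  have hsingle : ∀ i, Pi.single i 1 ∈ H := by
    intro i q
    have hplus := hσ.dilationNull_faceSum hχ ha i abs_one
      (intVec q + (1 / 2 : ℝ) • EuclideanSpace.single i (1 : ℝ))
    have hminus := hσ.dilationNull_faceSum hχ ha i (s := -1) (by simp)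
      (intVec q + (1 / 2 : ℝ) • EuclideanSpace.single i (1 : ℝ))
    refine (hplus.sub hminus).congr' (Eventually.of_forall fun N => ?_)
    have h := sum_latticeBox_shift_sub i N fun n => σ (intVec (n + q))
    simp only [A]
    rw [← Finset.sum_sub_distrib, ← Finset.sum_sub_distrib]
    have hcomm : ∀ n : Fin d → ℤ, n + (q + Pi.single i 1) = n + Pi.single i 1 + q :=
      fun n => by abel
    simp only [hcomm]
    rw [h]
    refine Finset.sum_congr rfl fun n _ => ?_
    simp only [facePoint, intVec_add, intVec_single]
    congr 2 <;> push_cast <;> module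
  have hp : p ∈ H := by
    rw [← Finset.univ_sum_single p]
    refine sum_mem fun i _ => ?_
    convert H.zsmul_mem (hsingle i) (p i) using 1
    rw [← Pi.single_smul, smul_eq_mul, mul_one]
  have := hp 0
  simpa only [A, zero_add, add_zero, intVec_add, intVec_zero] using this

end Symbol

/-- **`ℤ^d`-translation invariance of the Hadamard finite part of lattice sums over expanded
hypercubes, for non-integer order classical symbols:** if
`Σ_{|n|_∞≤N} σ(n) − Σ_{j<J} c_j N^{a+d−j} → S` and
`Σ_{|n|_∞≤N} σ(n+p) − Σ_{j<J} c'_j N^{a+d−j} → S'` (for all integers `J > Re(a)+d`),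
then `S' = S`. -/
theorem finite_part_lattice_sum_translation_invariant {d : ℕ} (hd : 0 < d)
    (χ : EuclideanSpace ℝ (Fin d) → ℝ) (hχ : IsCutoff χ) (a : ℂ) (ha : ∀ m : ℤ, a ≠ m)
    (σ : EuclideanSpace ℝ (Fin d) → ℂ) (σh : ℕ → EuclideanSpace ℝ (Fin d) → ℂ)
    (hσ : IsClassicalSymbol χ a σ σh)
    (p : Fin d → ℤ) (c c' : ℕ → ℂ) (S S' : ℂ)
    (hc : ∀ J : ℕ, a.re + d < J →
      Tendsto (fun N : ℕ =>
          (∑ n ∈ latticeBox d N, σ (intVec n))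
            - ∑ j ∈ Finset.range J, c j * (N : ℂ) ^ (a + (d : ℂ) - (j : ℂ)))
        atTop (𝓝 S))
    (hc' : ∀ J : ℕ, a.re + d < J →
      Tendsto (fun N : ℕ =>
          (∑ n ∈ latticeBox d N, σ (intVec n + intVec p))
            - ∑ j ∈ Finset.range J, c' j * (N : ℂ) ^ (a + (d : ℂ) - (j : ℂ)))
        atTop (𝓝 S')) :
    S' = S := by
  obtain ⟨J, hJ⟩ := exists_nat_gt (a.re + d)
  have hD := hσ.dilationNull_sum_translate_sub hχ ha p
  have hpow : DilationNull fun N => ∑ j ∈ Finset.range J,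
      (c' j - c j) * (N : ℂ) ^ (a + (d : ℂ) - (j : ℂ)) := by
    refine DilationNull.sum _ _ fun j _ => (dilationNull_natCast_cpow fun m hm => ?_).const_mul _
    apply ha (m - d + j)
    push_cast
    linear_combination hm
  refine sub_eq_zero.1 ((hD.sub hpow).eq_zero_of_tendsto ?_)
  refine ((hc' J hJ).sub (hc J hJ)).congr fun N => ?_
  simp only [sub_mul, Finset.sum_sub_distrib]
  ring
end
end
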